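/- arXiv:2403.10714 — 7 statements merged into one kernel-verified Lean document; each statement's English description precedes it below -/
import Mathlib

section
/- Fix integers θ ≥ 2 and k ≥ 1, and let A be the (k+1)×(k+1) core matrix of the hyperrecursive-tree urn. Then the characteristic polynomial of A equals (X − 1)·(X + (θ − 1))^k; in particular, the eigenvalues of A are 1 with algebraic multiplicity 1 and 1 − θ with algebraic multiplicity k. -/
open Polynomial

/-- The core matrix `A` of the hyperrecursive-tree urn with parameter `θ` and `k+1` colors:
first row `(−(θ−2), θ−1, 0, …, 0)`; for `2 ≤ i ≤ k` the `i`-th row has first entry `1`,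
entry `−(θ−1)` in position `i`, entry `θ−1` in position `i+1`, zeros elsewhere;
last row `(1, 0, …, 0)`. (Rows and columns are 0-indexed here.) -/
def coreMatrix (θ k : ℕ) : Matrix (Fin (k + 1)) (Fin (k + 1)) ℤ := fun i j =>
  if i.val = 0 then
    (if j.val = 0 then -((θ : ℤ) - 2) else if j.val = 1 then (θ : ℤ) - 1 else 0)
  else if i.val = k then
    (if j.val = 0 then 1 else 0)
  else
    (if j.val = 0 then 1
     else if j = i then -((θ : ℤ) - 1)
     else if j.val = i.val + 1 then (θ : ℤ) - 1
     else 0)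

/-- The lower unitriangular matrix of ones, which conjugates `coreMatrix` to a triangular matrix. -/
def lowerOnes (n : ℕ) : Matrix (Fin n) (Fin n) ℤ := fun i j => if j ≤ i then 1 else 0

/-- The upper bidiagonal form of `coreMatrix`. -/
def coreTriangular (θ k : ℕ) : Matrix (Fin (k + 1)) (Fin (k + 1)) ℤ := fun i j =>
  (if i = 0 then (if j = 0 then 1 else 0) else 0)
    + (if i = ⟨j.val - 1, by omega⟩ then (θ : ℤ) - 1 else 0)
    - (if i = j then (θ : ℤ) - 1 else 0)

theorem det_lowerOnes (n : ℕ) : (lowerOnes n).det = 1 := by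
  rw [Matrix.det_of_isLowerTriangular]
  · simp [lowerOnes]
  · intro i j hij
    have h : i < j := hij
    simp [lowerOnes, h]

theorem coreMatrix_apply_eq_add_sub (θ k : ℕ) (hk : 1 ≤ k) (i j : Fin (k + 1)) :
    coreMatrix θ k i j = (if j = 0 then 1 else 0)
      + (if j = ⟨min (i.val + 1) k, by omega⟩ then (θ : ℤ) - 1 else 0)
      - (if j = i then (θ : ℤ) - 1 else 0) := by
  have := i.isLt
  have := j.isLt
  simp only [coreMatrix, Fin.ext_iff, Fin.val_zero]
  split_ifs <;> omega

theorem coreMatrix_mul_lowerOnes (θ k : ℕ) (hk : 1 ≤ k) :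
    coreMatrix θ k * lowerOnes (k + 1) = lowerOnes (k + 1) * coreTriangular θ k := by
  ext i j
  have := i.isLt
  have := j.isLt
  simp only [Matrix.mul_apply, coreMatrix_apply_eq_add_sub θ k hk, coreTriangular, add_mul,
    sub_mul, mul_add, mul_sub, Finset.sum_add_distrib, Finset.sum_sub_distrib, ite_mul, mul_ite,
    zero_mul, mul_zero, Finset.sum_ite_eq', Finset.mem_univ, if_true]
  simp only [lowerOnes, Fin.le_def, Fin.ext_iff, Fin.val_zero]
  split_ifs <;> omega

theorem charpoly_coreTriangular (θ k : ℕ) :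
    (coreTriangular θ k).charpoly = (X - 1) * (X + C ((θ : ℤ) - 1)) ^ k := by
  rw [Matrix.charpoly_of_isUpperTriangular, Fin.prod_univ_succ]
  · have h (i : Fin k) : coreTriangular θ k i.succ i.succ = -((θ : ℤ) - 1) := by
      simp [coreTriangular, Fin.ext_iff]
    simp only [h, Finset.prod_const, Finset.card_univ, Fintype.card_fin, C_neg, sub_neg_eq_add]
    simp [coreTriangular]
  · intro i j hij
    have h : j.val < i.val := hij
    simp only [coreTriangular, Fin.ext_iff, Fin.val_zero]
    split_ifs <;> omega

/-- For integers `θ ≥ 2` and `k ≥ 1`, the characteristic polynomial of the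
`(k+1)×(k+1)` core matrix of the hyperrecursive-tree urn equals `(X − 1)·(X + (θ − 1))^k`;
in particular its eigenvalues are `1` with algebraic multiplicity `1` and `1 − θ` with
algebraic multiplicity `k`. -/
theorem coreMatrix_charpoly (θ k : ℕ) (hθ : 2 ≤ θ) (hk : 1 ≤ k) :
    (coreMatrix θ k).charpoly = (X - 1) * (X + C ((θ : ℤ) - 1)) ^ k := by
  obtain ⟨L, hL⟩ : IsUnit (lowerOnes (k + 1)) := by
    simp [Matrix.isUnit_iff_isUnit_det, det_lowerOnes]
  have h := coreMatrix_mul_lowerOnes θ k hk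
  rw [← hL, ← Units.eq_mul_inv_iff_mul_eq] at h
  rw [h, Matrix.coe_units_inv, Matrix.charpoly_units_conj, charpoly_coreTriangular]
end

section
/- Fix integers θ ≥ 2 and k ≥ 1, and let A be the (k+1)×(k+1) core matrix of the hyperrecursive-tree urn. Let v_1 ∈ ℝ^{k+1} be the row vector with entries v_{1,i} = (θ−1)^{i−1}/θ^i for 1 ≤ i ≤ k and v_{1,k+1} = ((θ−1)/θ)^k. Then v_1 A = v_1 (i.e., v_1 is a left eigenvector of A for the eigenvalue 1), and the entries of v_1 sum to 1. -/
/-- The core matrix `A` of the hyperrecursive-tree urn with parameter `θ` and `k+1` colors,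
with real entries: first row `(−(θ−2), θ−1, 0, …, 0)`; for `2 ≤ i ≤ k` the `i`-th row has
first entry `1`, entry `−(θ−1)` in position `i`, entry `θ−1` in position `i+1`, zeros
elsewhere; last row `(1, 0, …, 0)`. (Rows and columns are 0-indexed here.) -/
def coreMatrixR (θ k : ℕ) : Matrix (Fin (k + 1)) (Fin (k + 1)) ℝ := fun i j =>
  if i.val = 0 then
    (if j.val = 0 then -((θ : ℝ) - 2) else if j.val = 1 then (θ : ℝ) - 1 else 0)
  else if i.val = k then
    (if j.val = 0 then 1 else 0)
  else
    (if j.val = 0 then 1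
     else if j = i then -((θ : ℝ) - 1)
     else if j.val = i.val + 1 then (θ : ℝ) - 1
     else 0)

/-- The principal left eigenvector `v₁` of the core matrix: `v_{1,i} = (θ−1)^{i−1}/θ^i`
for `1 ≤ i ≤ k` and `v_{1,k+1} = ((θ−1)/θ)^k` (0-indexed below). -/
noncomputable def principalV (θ k : ℕ) : Fin (k + 1) → ℝ := fun i =>
  if i.val = k then (((θ : ℝ) - 1) / θ) ^ k
  else ((θ : ℝ) - 1) ^ i.val / (θ : ℝ) ^ (i.val + 1)

theorem principalV_sum (θ k : ℕ) (hθ : θ ≠ 0) : ∑ i, principalV θ k i = 1 := by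
  have hθ' : (θ : ℝ) ≠ 0 := Nat.cast_ne_zero.mpr hθ
  have hpartial (n : ℕ) :
      ∑ i ∈ Finset.range n, ((θ : ℝ) - 1) ^ i / (θ : ℝ) ^ (i + 1) = 1 - (((θ : ℝ) - 1) / θ) ^ n := by
    induction n with
    | zero => simp
    | succ n ih =>
      rw [Finset.sum_range_succ, ih, div_pow, div_pow]
      field_simp
      ring
  have hinit : ∑ i : Fin k, principalV θ k i.castSucc = 1 - (((θ : ℝ) - 1) / θ) ^ k := by
    rw [← hpartial, Finset.sum_range]
    refine Finset.sum_congr rfl fun i _ => ?_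
    simp [principalV, i.isLt.ne]
  rw [Fin.sum_univ_castSucc, hinit]
  simp [principalV]

theorem coreMatrixR_zero_right (θ k : ℕ) (i : Fin (k + 1)) :
    coreMatrixR θ k i 0 = 1 - if i = 0 then (θ : ℝ) - 1 else 0 := by
  by_cases hi : i = 0
  · simp [coreMatrixR, hi]
    ring
  · simp [coreMatrixR, hi]

theorem coreMatrixR_succ_right (θ k : ℕ) (i : Fin (k + 1)) (j : Fin k) :
    coreMatrixR θ k i j.succ =
      (if i = j.castSucc then (θ : ℝ) - 1 else 0) -
        if i = j.succ then (if j.val + 1 = k then 0 else (θ : ℝ) - 1) else 0 := by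
  have hj := j.isLt
  simp only [coreMatrixR, Fin.ext_iff, Fin.val_succ, Fin.val_castSucc]
  split_ifs <;> first | contradiction | omega | simp

/-- For integers `θ ≥ 2` and `k ≥ 1`, the row vector `v₁` with entries
`v_{1,i} = (θ−1)^{i−1}/θ^i` for `1 ≤ i ≤ k` and `v_{1,k+1} = ((θ−1)/θ)^k` satisfies
`v₁ A = v₁` (it is a left eigenvector of the core matrix `A` for the eigenvalue `1`),
and its entries sum to `1`. -/
theorem principal_left_eigenvector (θ k : ℕ) (hθ : 2 ≤ θ) (hk : 1 ≤ k) :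
    (∀ j, ∑ i, principalV θ k i * coreMatrixR θ k i j = principalV θ k j) ∧
    (∑ i, principalV θ k i = 1) := by
  have hθ' : (θ : ℝ) ≠ 0 := by positivity
  have hsum := principalV_sum θ k (by omega)
  refine ⟨fun j => ?_, hsum⟩
  cases j using Fin.cases with
  | zero =>
    have h0 : principalV θ k 0 = 1 / θ := by
      simp [principalV, (Nat.ne_of_gt hk).symm]
    simp only [coreMatrixR_zero_right, mul_sub, mul_one, Finset.sum_sub_distrib, hsum, mul_ite,
      mul_zero, Finset.sum_ite_eq', Finset.mem_univ, if_true, h0]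
    field_simp
    ring
  | succ j =>
    simp only [coreMatrixR_succ_right, mul_sub, Finset.sum_sub_distrib, mul_ite, mul_zero,
      Finset.sum_ite_eq', Finset.mem_univ, if_true]
    have hj : j.val ≠ k := j.isLt.ne
    by_cases hjk : j.val + 1 = k
    · simp only [principalV, Fin.val_castSucc, Fin.val_succ, hj, hjk, if_true, if_false, div_pow]
      have hpow (x : ℝ) : x ^ k = x ^ j.val * x := by rw [← pow_succ, hjk]
      simp only [hpow]
      field_simp
      ring
    · simp only [principalV, Fin.val_castSucc, Fin.val_succ, hj, hjk, if_false]
      field_simp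
      ring
end

section
/- Fix an integer θ ≥ 2 and let (m_n)_{n≥0} be the real sequence defined by m_0 = θ and m_n = (n/(n+θ−1)) m_{n−1} + 1 for n ≥ 1. Then for every n ≥ 0, m_n = n/θ + 1 + (θ−1) Γ(θ) Γ(n+1)/Γ(n+θ). (This sequence is the exact mean E[X_{n,1}^{(θ)}] of the number of vertices at containment level 1 in a hyperrecursive tree with parameter θ at age n.) -/
/-- For an integer `θ ≥ 2`, the sequence defined by `m_0 = θ` and
`m_n = (n/(n+θ−1)) m_{n−1} + 1` (which is the exact mean `E[X_{n,1}^{(θ)}]` of the number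
of vertices at containment level 1 in a hyperrecursive tree with parameter `θ` at age `n`)
satisfies, for every `n ≥ 0`,
`m_n = n/θ + 1 + (θ−1) Γ(θ) Γ(n+1)/Γ(n+θ)`. -/
theorem hyperrecursive_level_one_mean (θ : ℕ) (hθ : 2 ≤ θ) (m : ℕ → ℝ)
    (h0 : m 0 = θ)
    (hrec : ∀ n : ℕ, 1 ≤ n →
      m n = ((n : ℝ) / ((n : ℝ) + θ - 1)) * m (n - 1) + 1) :
    ∀ n : ℕ, m n = (n : ℝ) / θ + 1 +
      ((θ : ℝ) - 1) * Real.Gamma θ * Real.Gamma (n + 1) / Real.Gamma ((n : ℝ) + θ) := by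
  have hθ0 : (0 : ℝ) < θ := by exact_mod_cast (by omega : 0 < θ)
  intro n
  induction n with
  | zero =>
    have hΓ : Real.Gamma θ ≠ 0 := (Real.Gamma_pos_of_pos hθ0).ne'
    rw [h0]
    simp only [Nat.cast_zero, zero_add, zero_div, Real.Gamma_one]
    field_simp
    ring
  | succ n ih =>
    have hpos : (0 : ℝ) < (n : ℝ) + θ := by positivity
    have hΓ : Real.Gamma ((n : ℝ) + θ) ≠ 0 := (Real.Gamma_pos_of_pos hpos).ne'
    have hnum : Real.Gamma ((n : ℝ) + 1 + 1) = ((n : ℝ) + 1) * Real.Gamma ((n : ℝ) + 1) :=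
      Real.Gamma_add_one (by positivity)
    have hden : Real.Gamma ((n : ℝ) + 1 + θ) = ((n : ℝ) + θ) * Real.Gamma ((n : ℝ) + θ) := by
      rw [add_right_comm, Real.Gamma_add_one hpos.ne']
    have hcoeff : (n : ℝ) + 1 + θ - 1 = n + θ := by ring
    rw [hrec (n + 1) (by omega), Nat.add_sub_cancel, ih]
    push_cast
    rw [hnum, hden, hcoeff]
    field_simp
    ring
end

section
/- Fix an integer θ ≥ 2. Let (m_n)_{n≥0} be defined by m_0 = θ and m_n = (n/(n+θ−1)) m_{n−1} + 1, and let (w_n)_{n≥0} be defined by w_0 = 0 and w_n = (n/(n+θ−1)) w_{n−1} + ((θ−1)/(n+θ−1)) m_{n−1} for n ≥ 1. Then for every n ≥ 0, w_n = ((θ−1)/θ²)(n+θ) + Γ(θ) (Γ(n+1)/Γ(n+θ)) ((θ−1)² H_n − (θ−1)/θ), where H_n = Σ_{j=1}^{n} 1/j is the n-th harmonic number. (This sequence is the exact mean E[X_{n,2}^{(θ)}] of the number of vertices at containment level 2 in a hyperrecursive tree with parameter θ at age n.) -/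
open Finset

/-- The normalized Gamma ratio `Γ(t) Γ(n+1) / Γ(n+t)` is multiplied by `(n+1)/(n+t)` when `n`
increases by one. -/
lemma Gamma_mul_ratio_succ {t : ℝ} (ht : 0 < t) (n : ℕ) :
    Real.Gamma t * (Real.Gamma ((n + 1 : ℕ) + 1) / Real.Gamma ((n + 1 : ℕ) + t)) =
      ((n : ℝ) + 1) / (n + t) * (Real.Gamma t * (Real.Gamma (n + 1) / Real.Gamma (n + t))) := by
  have hnt : (0 : ℝ) < n + t := by positivity
  have hG : Real.Gamma (n + t) ≠ 0 := (Real.Gamma_pos_of_pos hnt).ne'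
  rw [show ((n + 1 : ℕ) : ℝ) + t = (n + t) + 1 by push_cast; ring, Real.Gamma_add_one hnt.ne',
    Real.Gamma_add_one (by positivity : ((n + 1 : ℕ) : ℝ) ≠ 0)]
  push_cast
  field_simp

/-- The solution of `m_{n+1} = (n+1)/(n+t) m_n + 1` with `m_0 = t`. -/
lemma level_one_mean_eq {t : ℝ} (ht : 0 < t) {m : ℕ → ℝ} (hm0 : m 0 = t)
    (hm : ∀ n : ℕ, m (n + 1) = ((n : ℝ) + 1) / (n + t) * m n + 1) (n : ℕ) :
    m n = (n + t) / t +
      (t - 1) * (Real.Gamma t * (Real.Gamma (n + 1) / Real.Gamma (n + t))) := by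
  induction n with
  | zero =>
    have hG : Real.Gamma t ≠ 0 := (Real.Gamma_pos_of_pos ht).ne'
    simp [hm0, hG, ht.ne']
  | succ n ih =>
    have hnt : (0 : ℝ) < n + t := by positivity
    rw [hm, ih, Gamma_mul_ratio_succ ht]
    push_cast
    field_simp
    ring

/-- For an integer `θ ≥ 2`, let `m_0 = θ`,
`m_n = (n/(n+θ−1)) m_{n−1} + 1`, and `w_0 = 0`,
`w_n = (n/(n+θ−1)) w_{n−1} + ((θ−1)/(n+θ−1)) m_{n−1}` (so `w_n` is the exact mean
`E[X_{n,2}^{(θ)}]` of the number of vertices at containment level 2 in a hyperrecursive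
tree with parameter `θ` at age `n`). Then for every `n ≥ 0`,
`w_n = ((θ−1)/θ²)(n+θ) + Γ(θ) (Γ(n+1)/Γ(n+θ)) ((θ−1)² H_n − (θ−1)/θ)`,
where `H_n` is the `n`-th harmonic number. -/
theorem hyperrecursive_level_two_mean (θ : ℕ) (hθ : 2 ≤ θ) (m w : ℕ → ℝ)
    (hm0 : m 0 = θ)
    (hmrec : ∀ n : ℕ, 1 ≤ n →
      m n = ((n : ℝ) / ((n : ℝ) + θ - 1)) * m (n - 1) + 1)
    (hw0 : w 0 = 0)
    (hwrec : ∀ n : ℕ, 1 ≤ n →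
      w n = ((n : ℝ) / ((n : ℝ) + θ - 1)) * w (n - 1) +
        (((θ : ℝ) - 1) / ((n : ℝ) + θ - 1)) * m (n - 1)) :
    ∀ n : ℕ, w n = (((θ : ℝ) - 1) / θ ^ 2) * ((n : ℝ) + θ) +
      Real.Gamma θ * (Real.Gamma (n + 1) / Real.Gamma ((n : ℝ) + θ)) *
        (((θ : ℝ) - 1) ^ 2 * (∑ j ∈ Finset.range n, (1 : ℝ) / (j + 1)) -
          ((θ : ℝ) - 1) / θ) := by
  have ht : (0 : ℝ) < θ := by positivity
  have hm (n : ℕ) : m (n + 1) = ((n : ℝ) + 1) / (n + θ) * m n + 1 := by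
    rw [hmrec (n + 1) (by omega), Nat.add_sub_cancel]
    push_cast
    ring
  have hw (n : ℕ) : w (n + 1) =
      ((n : ℝ) + 1) / (n + θ) * w n + ((θ : ℝ) - 1) / (n + θ) * m n := by
    rw [hwrec (n + 1) (by omega), Nat.add_sub_cancel]
    push_cast
    ring
  intro n
  induction n with
  | zero =>
    have hG : Real.Gamma (θ : ℝ) ≠ 0 := (Real.Gamma_pos_of_pos ht).ne'
    simp only [hw0, Nat.cast_zero, zero_add, Real.Gamma_one, Finset.range_zero,
      Finset.sum_empty]
    field_simp
    ring
  | succ n ih =>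
    have hnt : (0 : ℝ) < n + θ := by positivity
    rw [hw, ih, level_one_mean_eq ht hm0 hm, Gamma_mul_ratio_succ ht, Finset.sum_range_succ]
    generalize Real.Gamma (θ : ℝ) * (Real.Gamma (n + 1) / Real.Gamma (n + θ)) = R
    generalize ∑ j ∈ Finset.range n, (1 : ℝ) / (j + 1) = H
    push_cast
    field_simp
    ring
end

section
/- Fix integers r ≥ 1 and θ ≥ 2. Define, for n ≥ 2, S_n = (Γ(n+1)/Γ(n+θ)) Σ_{ℓ=2}^{n} (Γ(ℓ+θ)/Γ(ℓ+1)) (ln ℓ)^{r−1}/ℓ². Then: if θ ≥ 3, S_n = O((ln n)^{r−1}/n) as n → ∞; and if θ = 2, S_n = O((ln n)^{r}/n) as n → ∞. -/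
open Finset Filter Asymptotics

theorem gamma_ratio_eq_ascFactorial (n m : ℕ) :
    Real.Gamma ((n : ℝ) + (m + 1 : ℕ)) / Real.Gamma ((n : ℝ) + 1)
      = ((n + 1).ascFactorial m : ℝ) := by
  have h : (n : ℝ) + (m + 1 : ℕ) = ((n + m : ℕ) : ℝ) + 1 := by push_cast; ring
  rw [h, Real.Gamma_nat_eq_factorial, Real.Gamma_nat_eq_factorial,
    ← Nat.factorial_mul_ascFactorial, Nat.cast_mul,
    mul_div_cancel_left₀ _ (Nat.cast_ne_zero.mpr n.factorial_ne_zero)]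

theorem pow_le_gamma_ratio (n m : ℕ) :
    (n : ℝ) ^ m ≤ Real.Gamma ((n : ℝ) + (m + 1 : ℕ)) / Real.Gamma ((n : ℝ) + 1) := by
  rw [gamma_ratio_eq_ascFactorial]
  have h : (n + 1) ^ m ≤ (n + 1).ascFactorial m := Nat.pow_succ_le_ascFactorial _ _
  exact_mod_cast (Nat.pow_le_pow_left n.le_succ m).trans h

theorem gamma_ratio_le_mul_pow {n : ℕ} (hn : 1 ≤ n) (m : ℕ) :
    Real.Gamma ((n : ℝ) + (m + 1 : ℕ)) / Real.Gamma ((n : ℝ) + 1)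
      ≤ ((m : ℝ) + 1) ^ m * (n : ℝ) ^ m := by
  rw [gamma_ratio_eq_ascFactorial, ← mul_pow]
  have h : (n + 1).ascFactorial m ≤ ((m + 1) * n) ^ m :=
    (Nat.ascFactorial_le_pow_add n m).trans (Nat.pow_le_pow_left (by nlinarith) m)
  exact_mod_cast h

/-- The weighted sum is controlled by the corresponding sum of powers. -/
theorem norm_gamma_ratio_log_sum_le (k m : ℕ) {n : ℕ} (hn : 1 ≤ n) :
    ‖(Real.Gamma ((n : ℝ) + 1) / Real.Gamma ((n : ℝ) + (m + 1 : ℕ))) *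
        ∑ ℓ ∈ Finset.Icc 2 n,
          (Real.Gamma ((ℓ : ℝ) + (m + 1 : ℕ)) / Real.Gamma ((ℓ : ℝ) + 1)) *
            (Real.log ℓ) ^ k / (ℓ : ℝ) ^ 2‖
      ≤ ((m : ℝ) + 1) ^ m * (Real.log n) ^ k *
          (((n : ℝ) ^ m)⁻¹ * ∑ ℓ ∈ Finset.Icc 2 n, (ℓ : ℝ) ^ m / (ℓ : ℝ) ^ 2) := by
  have hn0 : (0 : ℝ) < n := by positivity
  have hratio : ∀ ℓ : ℕ,
      0 ≤ Real.Gamma ((ℓ : ℝ) + (m + 1 : ℕ)) / Real.Gamma ((ℓ : ℝ) + 1) := fun ℓ =>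
    (by positivity : (0 : ℝ) ≤ (ℓ : ℝ) ^ m).trans (pow_le_gamma_ratio ℓ m)
  have hlog : ∀ ℓ : ℕ, 0 ≤ Real.log ℓ := Real.log_natCast_nonneg
  have hinv : Real.Gamma ((n : ℝ) + 1) / Real.Gamma ((n : ℝ) + (m + 1 : ℕ))
      ≤ ((n : ℝ) ^ m)⁻¹ := by
    rw [← inv_div]
    exact inv_anti₀ (by positivity) (pow_le_gamma_ratio n m)
  have hsum : ∑ ℓ ∈ Finset.Icc 2 n,
        (Real.Gamma ((ℓ : ℝ) + (m + 1 : ℕ)) / Real.Gamma ((ℓ : ℝ) + 1)) *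
          (Real.log ℓ) ^ k / (ℓ : ℝ) ^ 2
      ≤ ((m : ℝ) + 1) ^ m * (Real.log n) ^ k *
          ∑ ℓ ∈ Finset.Icc 2 n, (ℓ : ℝ) ^ m / (ℓ : ℝ) ^ 2 := by
    rw [Finset.mul_sum]
    refine Finset.sum_le_sum fun ℓ hℓ => ?_
    obtain ⟨h2, hle⟩ := Finset.mem_Icc.mp hℓ
    have hll : Real.log ℓ ≤ Real.log n :=
      Real.log_le_log (by positivity) (Nat.cast_le.mpr hle)
    calc _ ≤ (((m : ℝ) + 1) ^ m * (ℓ : ℝ) ^ m) * (Real.log n) ^ k / (ℓ : ℝ) ^ 2 := by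
          gcongr
          exact gamma_ratio_le_mul_pow (by omega) m
      _ = _ := by ring
  have hsum_nonneg : 0 ≤ ∑ ℓ ∈ Finset.Icc 2 n,
        (Real.Gamma ((ℓ : ℝ) + (m + 1 : ℕ)) / Real.Gamma ((ℓ : ℝ) + 1)) *
          (Real.log ℓ) ^ k / (ℓ : ℝ) ^ 2 :=
    Finset.sum_nonneg fun ℓ _ =>
      div_nonneg (mul_nonneg (hratio ℓ) (pow_nonneg (hlog ℓ) k)) (by positivity)
  have hinv_nonneg : 0 ≤ Real.Gamma ((n : ℝ) + 1) / Real.Gamma ((n : ℝ) + (m + 1 : ℕ)) := by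
    rw [← inv_div]
    exact inv_nonneg.mpr (hratio n)
  rw [Real.norm_of_nonneg (mul_nonneg hinv_nonneg hsum_nonneg)]
  calc _ ≤ ((n : ℝ) ^ m)⁻¹ * (((m : ℝ) + 1) ^ m * (Real.log n) ^ k *
          ∑ ℓ ∈ Finset.Icc 2 n, (ℓ : ℝ) ^ m / (ℓ : ℝ) ^ 2) :=
        mul_le_mul hinv hsum hsum_nonneg (by positivity)
    _ = _ := by ring

theorem inv_pow_mul_sum_pow_div_sq_le (j : ℕ) {n : ℕ} (hn : 1 ≤ n) :
    ((n : ℝ) ^ (j + 2))⁻¹ * ∑ ℓ ∈ Finset.Icc 2 n, (ℓ : ℝ) ^ (j + 2) / (ℓ : ℝ) ^ 2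
      ≤ (n : ℝ)⁻¹ := by
  have hn0 : (0 : ℝ) < n := by positivity
  have hsum : ∑ ℓ ∈ Finset.Icc 2 n, (ℓ : ℝ) ^ (j + 2) / (ℓ : ℝ) ^ 2 ≤ n * (n : ℝ) ^ j := by
    have hterm : ∀ ℓ ∈ Finset.Icc 2 n, (ℓ : ℝ) ^ (j + 2) / (ℓ : ℝ) ^ 2 ≤ (n : ℝ) ^ j := by
      intro ℓ hℓ
      obtain ⟨h2, hle⟩ := Finset.mem_Icc.mp hℓ
      have h0 : (0 : ℝ) < ℓ := by positivity
      rw [pow_add, mul_div_cancel_right₀ _ (by positivity)]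
      gcongr
    refine (Finset.sum_le_card_nsmul _ _ _ hterm).trans ?_
    rw [nsmul_eq_mul, Nat.card_Icc]
    gcongr
    omega
  calc _ ≤ ((n : ℝ) ^ (j + 2))⁻¹ * (n * (n : ℝ) ^ j) := by gcongr
    _ = (n : ℝ)⁻¹ := by field_simp; ring

theorem sum_Icc_two_inv_le_log {n : ℕ} (hn : 1 ≤ n) :
    ∑ ℓ ∈ Finset.Icc 2 n, (ℓ : ℝ)⁻¹ ≤ Real.log n := by
  have h := harmonic_le_one_add_log n
  rw [harmonic_eq_sum_Icc, ← Finset.add_sum_Ioc_eq_sum_Icc hn] at h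
  push_cast at h
  have hI : Finset.Ioc 1 n = Finset.Icc 2 n := by ext; simp [Nat.succ_le_iff]
  rw [hI] at h
  linarith [inv_one (G := ℝ)]

/-- Fix integers `r ≥ 1` and `θ ≥ 2`, and for `n ≥ 2` let
`S_n = (Γ(n+1)/Γ(n+θ)) Σ_{ℓ=2}^{n} (Γ(ℓ+θ)/Γ(ℓ+1)) (ln ℓ)^{r−1}/ℓ²`. Then, as `n → ∞`:
if `θ ≥ 3` then `S_n = O((ln n)^{r−1}/n)`, and if `θ = 2` then `S_n = O((ln n)^{r}/n)`. -/
theorem gamma_ratio_log_sum_bigO (r θ : ℕ) (hr : 1 ≤ r) (hθ : 2 ≤ θ) :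
    (3 ≤ θ →
      (fun n : ℕ => (Real.Gamma ((n : ℝ) + 1) / Real.Gamma ((n : ℝ) + θ)) *
          ∑ ℓ ∈ Finset.Icc 2 n, (Real.Gamma ((ℓ : ℝ) + θ) / Real.Gamma ((ℓ : ℝ) + 1)) *
            (Real.log ℓ) ^ (r - 1) / (ℓ : ℝ) ^ 2)
        =O[atTop] fun n : ℕ => (Real.log n) ^ (r - 1) / (n : ℝ)) ∧
    (θ = 2 →
      (fun n : ℕ => (Real.Gamma ((n : ℝ) + 1) / Real.Gamma ((n : ℝ) + θ)) *
          ∑ ℓ ∈ Finset.Icc 2 n, (Real.Gamma ((ℓ : ℝ) + θ) / Real.Gamma ((ℓ : ℝ) + 1)) *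
            (Real.log ℓ) ^ (r - 1) / (ℓ : ℝ) ^ 2)
        =O[atTop] fun n : ℕ => (Real.log n) ^ r / (n : ℝ)) := by
  constructor
  · intro h3
    obtain ⟨j, rfl⟩ := Nat.exists_eq_add_of_le' h3
    refine IsBigO.of_bound (((j + 2 : ℕ) + 1 : ℝ) ^ (j + 2)) ?_
    filter_upwards [eventually_ge_atTop 2] with n hn
    refine (norm_gamma_ratio_log_sum_le (r - 1) (j + 2) (one_le_two.trans hn)).trans ?_
    have hlog : 0 ≤ Real.log n := Real.log_natCast_nonneg n
    rw [Real.norm_of_nonneg (by positivity), div_eq_mul_inv,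
      ← mul_assoc (_ ^ (j + 2)) (Real.log n ^ (r - 1))]
    exact mul_le_mul_of_nonneg_left
      (inv_pow_mul_sum_pow_div_sq_le j (one_le_two.trans hn)) (by positivity)
  · rintro rfl
    obtain ⟨k, rfl⟩ := Nat.exists_eq_add_of_le' hr
    refine IsBigO.of_bound (((1 : ℕ) + 1 : ℝ) ^ 1) ?_
    filter_upwards [eventually_ge_atTop 2] with n hn
    refine (norm_gamma_ratio_log_sum_le k 1 (one_le_two.trans hn)).trans ?_
    have hlog : 0 ≤ Real.log n := Real.log_natCast_nonneg n
    have hterm : ∀ ℓ : ℕ, (ℓ : ℝ) ^ 1 / (ℓ : ℝ) ^ 2 = (ℓ : ℝ)⁻¹ := fun ℓ => by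
      rcases eq_or_ne (ℓ : ℝ) 0 with h | h
      · simp [h]
      · field_simp
    simp only [hterm]
    rw [Real.norm_of_nonneg (by positivity)]
    calc _ ≤ ((1 : ℕ) + 1 : ℝ) ^ 1 * Real.log n ^ k * (((n : ℝ) ^ 1)⁻¹ * Real.log n) := by
          gcongr
          exact sum_Icc_two_inv_le_log (by omega)
      _ = _ := by rw [pow_one (n : ℝ), pow_succ]; ring
end

section
/- Fix an integer θ ≥ 2 and let A be the 4×4 matrix A = [[−(θ−2), θ−1, 0, 0], [1, −(θ−1), θ−1, 0], [1, 0, −(θ−1), θ−1], [1, 0, 0, 0]] (the core matrix of the hyperrecursive-tree urn with k = 3). Let T = [[1, −(θ−1), 1, 0], [1, 1, −θ/(θ−1), 1/(θ−1)], [1, 1, 0, −θ/(θ−1)²], [1, 1, 0, 0]] and J = [[1, 0, 0, 0], [0, −(θ−1), 1, 0], [0, 0, −(θ−1), 1], [0, 0, 0, −(θ−1)]]. Then T is invertible and A = T J T⁻¹ (equivalently, A T = T J and det T ≠ 0); i.e., J is a Jordan normal form of A, consisting of a 1×1 block for the eigenvalue 1 and a single 3×3 Jordan block for the eigenvalue −(θ−1).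 -/
/-- For an integer `θ ≥ 2`, let `A` be the 4×4 core matrix of the
hyperrecursive-tree urn with `k = 3`, and let `T`, `J` be the indicated matrices. Then
`T` is invertible (`det T ≠ 0`) and `A = T J T⁻¹` (equivalently `A T = T J`); that is,
`J` is a Jordan normal form of `A`, with a 1×1 block for the eigenvalue `1` and a single
3×3 Jordan block for the eigenvalue `−(θ−1)`. -/
theorem coreMatrix_jordan_decomposition (θ : ℕ) (hθ : 2 ≤ θ) :
    let A : Matrix (Fin 4) (Fin 4) ℝ :=
      !![-((θ : ℝ) - 2), (θ : ℝ) - 1, 0, 0;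
         1, -((θ : ℝ) - 1), (θ : ℝ) - 1, 0;
         1, 0, -((θ : ℝ) - 1), (θ : ℝ) - 1;
         1, 0, 0, 0]
    let T : Matrix (Fin 4) (Fin 4) ℝ :=
      !![1, -((θ : ℝ) - 1), 1, 0;
         1, 1, -(θ : ℝ) / ((θ : ℝ) - 1), 1 / ((θ : ℝ) - 1);
         1, 1, 0, -(θ : ℝ) / ((θ : ℝ) - 1) ^ 2;
         1, 1, 0, 0]
    let J : Matrix (Fin 4) (Fin 4) ℝ :=
      !![1, 0, 0, 0;
         0, -((θ : ℝ) - 1), 1, 0;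
         0, 0, -((θ : ℝ) - 1), 1;
         0, 0, 0, -((θ : ℝ) - 1)]
    T.det ≠ 0 ∧ A = T * J * T⁻¹ ∧ A * T = T * J := by
  intro A T J
  have hpos : (0 : ℝ) < (θ : ℝ) - 1 := by
    have : (2 : ℝ) ≤ θ := by exact_mod_cast hθ
    linarith
  have hm : (θ : ℝ) - 1 ≠ 0 := hpos.ne'
  have hdet : T.det = (θ : ℝ) ^ 3 / ((θ : ℝ) - 1) ^ 3 := by
    simp [T, Matrix.det_succ_row_zero, Fin.sum_univ_succ, Fin.succAbove]
    field_simp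
    ring
  have hT : T.det ≠ 0 := by
    rw [hdet]
    have : (0 : ℝ) < θ := by linarith
    positivity
  have hAT : A * T = T * J := by
    ext i j
    fin_cases i <;> fin_cases j <;>
      simp [A, T, J, Matrix.mul_apply, Fin.sum_univ_succ] <;> field_simp <;> ring
  refine ⟨hT, ?_, hAT⟩
  rw [← hAT, Matrix.mul_nonsing_inv_cancel_right _ _ hT.isUnit]
end

section
/- Fix an integer θ ≥ 2 and let (Y_n)_{n≥0} be the global containment profile process of the hyperrecursive tree with parameter θ, truncated at level k = 3, so that X_n = (Y_{n,1}, Y_{n,2}, Y_{n,3}) records the numbers of vertices contained in exactly 1, 2, and 3 hyperedges at time n. Then, as n → ∞, (1/√n)(X_n − (n/θ, (θ−1)n/θ², (θ−1)²n/θ³)) converges in distribution to the trivariate normal distribution N_3(0, Σ_∞^{(θ)}), where Σ_∞^{(θ)} is the symmetric 3×3 matrix with entries Σ_∞^{(θ)}[1,1] = (θ−1)²/(θ²(2θ−1)); Σ_∞^{(θ)}[1,2] = −(θ−1)²(θ²+2θ−1)/(θ³(2θ−1)²); Σ_∞^{(θ)}[1,3] = −(θ−1)²(θ⁴+θ³−7θ²+5θ−1)/(θ⁴(2θ−1)³);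 Σ_∞^{(θ)}[2,2] = (θ−1)²(6θ⁴−6θ³+8θ²−5θ+1)/(θ⁴(2θ−1)³); Σ_∞^{(θ)}[2,3] = −(θ−1)²(3θ⁶−16θ⁴+32θ³−24θ²+8θ−1)/(θ⁵(2θ−1)⁴); Σ_∞^{(θ)}[3,3] = (θ−1)²(26θ⁸−74θ⁷+112θ⁶−152θ⁵+170θ⁴−121θ³+50θ²−11θ+1)/(θ⁶(2θ−1)⁵). -/
open MeasureTheory Finset Filter

/-- The replacement vector `a_s = (1 − s_1, s_1 − s_2, s_2 − s_3, s_3) ∈ ℤ^4`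
of the hyperrecursive-tree urn truncated at level `k = 3` (0-indexed). -/
def replVecZ3 (s : Fin 4 → ℕ) : Fin 4 → ℤ :=
  ![1 - (s 0 : ℤ), (s 0 : ℤ) - s 1, (s 1 : ℤ) - s 2, (s 2 : ℤ)]

theorem Nat.descFactorial_mul_choose_eq_ite (y s r : ℕ) :
    s.descFactorial r * y.choose s =
      y.descFactorial r * if r ≤ s then (y - r).choose (s - r) else 0 := by
  split_ifs with h
  · have := Nat.choose_mul (n := y) h
    rw [Nat.descFactorial_eq_factorial_mul_choose, Nat.descFactorial_eq_factorial_mul_choose,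
      mul_assoc, mul_assoc, ← this, mul_comm (s.choose r)]
  · rw [Nat.descFactorial_of_lt (not_le.1 h)]; simp

theorem Finset.sum_piAntidiag_univ_prod_coeff {ι : Type*} [Fintype ι] [DecidableEq ι]
    {R : Type*} [CommSemiring R] (f : ι → PowerSeries R) (m : ℕ) :
    ∑ s ∈ piAntidiag (univ : Finset ι) m, ∏ i, PowerSeries.coeff (s i) (f i) =
      PowerSeries.coeff m (∏ i, f i) := by
  rw [PowerSeries.coeff_prod, finsuppAntidiag, sum_map, ← sum_attach]
  rfl

/-- Factorial moments of the multivariate hypergeometric weights. -/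
theorem Finset.sum_piAntidiag_prod_descFactorial_mul_choose {ι : Type*} [Fintype ι]
    [DecidableEq ι] (y r : ι → ℕ) (m : ℕ) :
    (∑ i, y i).descFactorial (∑ i, r i) *
      ∑ s ∈ piAntidiag univ m, ∏ i, ((s i).descFactorial (r i) * (y i).choose (s i)) =
      m.descFactorial (∑ i, r i) * (∏ i, (y i).descFactorial (r i)) *
        (∑ i, y i).choose m := by
  have hcoeff (n k l : ℕ) :
      PowerSeries.coeff l ((PowerSeries.X : PowerSeries ℕ) ^ k * (1 + PowerSeries.X) ^ n) =
        if k ≤ l then n.choose (l - k) else 0 := by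
    rw [PowerSeries.coeff_X_pow_mul']
    split_ifs with h
    · have := Polynomial.coeff_one_add_X_pow ℕ n (l - k)
      rw [← Polynomial.coeff_coe] at this
      simpa using this
    · rfl
  have hterm (s : ι → ℕ) (i : ι) : (s i).descFactorial (r i) * (y i).choose (s i) =
      PowerSeries.coeff (s i) (PowerSeries.C ((y i).descFactorial (r i)) *
        (PowerSeries.X ^ r i * (1 + PowerSeries.X) ^ (y i - r i))) := by
    rw [PowerSeries.coeff_C_mul, hcoeff, Nat.descFactorial_mul_choose_eq_ite]
  simp_rw [hterm]
  rw [sum_piAntidiag_univ_prod_coeff, prod_mul_distrib, ← map_prod, PowerSeries.coeff_C_mul,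
    prod_mul_distrib, prod_pow_eq_pow_sum, prod_pow_eq_pow_sum, hcoeff]
  by_cases h : ∀ i, r i ≤ y i
  · rw [sum_tsub_distrib _ fun i _ ↦ h i, mul_right_comm, Nat.descFactorial_mul_choose_eq_ite]
    ring
  · push Not at h
    obtain ⟨i, hi⟩ := h
    have : ∏ i, (y i).descFactorial (r i) = 0 :=
      prod_eq_zero (mem_univ i) (Nat.descFactorial_of_lt hi)
    simp [this]

/-- The probability that a uniform `m`-subset of a population split into classes of sizes `y i`
contains `s i` elements of class `i`. -/
noncomputable def hypergeomProb {ι : Type*} [Fintype ι] (m : ℕ) (y s : ι → ℕ) : ℝ :=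
  (∏ i, ((y i).choose (s i) : ℝ)) / ((∑ i, y i).choose m : ℝ)

theorem hypergeomProb_nonneg {ι : Type*} [Fintype ι] {m : ℕ} {y : ι → ℕ} (s : ι → ℕ) :
    0 ≤ hypergeomProb m y s := by
  unfold hypergeomProb; positivity

section Hypergeometric

variable {ι : Type*} [Fintype ι] [DecidableEq ι] {m : ℕ} {y : ι → ℕ}

theorem sum_hypergeomProb_mul_descFactorial (hm : m ≤ ∑ i, y i) (r : ι → ℕ) :
    ((∑ i, y i).descFactorial (∑ i, r i) : ℝ) *
      ∑ s ∈ piAntidiag univ m, hypergeomProb m y s * ∏ i, ((s i).descFactorial (r i) : ℝ) =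
      m.descFactorial (∑ i, r i) * ∏ i, ((y i).descFactorial (r i) : ℝ) := by
  have h := congrArg (Nat.cast (R := ℝ)) (sum_piAntidiag_prod_descFactorial_mul_choose y r m)
  have h0 : ((∑ i, y i).choose m : ℝ) ≠ 0 := by exact_mod_cast (Nat.choose_pos hm).ne'
  push_cast [prod_mul_distrib] at h
  unfold hypergeomProb
  rw [← mul_left_inj' h0, ← h, mul_assoc, sum_mul]
  congr 1
  refine sum_congr rfl fun s _ ↦ ?_
  field_simp

theorem sum_hypergeomProb (hm : m ≤ ∑ i, y i) :
    ∑ s ∈ piAntidiag univ m, hypergeomProb m y s = 1 := by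
  simpa using sum_hypergeomProb_mul_descFactorial hm 0

theorem sum_hypergeomProb_mul (hm : m ≤ ∑ i, y i) (i : ι) :
    ((∑ i, y i : ℕ) : ℝ) * ∑ s ∈ piAntidiag univ m, hypergeomProb m y s * s i = m * y i := by
  have h (s : ι → ℕ) : ∏ k, ((s k).descFactorial ((Pi.single i 1 : ι → ℕ) k) : ℝ) = s i := by
    rw [prod_eq_single i] <;> simp +contextual
  have := sum_hypergeomProb_mul_descFactorial hm (Pi.single i 1)
  simp_rw [h] at this
  simpa using this

theorem sum_hypergeomProb_mul_mul (hm : m ≤ ∑ i, y i) (i j : ι) :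
    ((∑ i, y i : ℕ) : ℝ) * (((∑ i, y i : ℕ) : ℝ) - 1) *
      ∑ s ∈ piAntidiag univ m, hypergeomProb m y s *
        (s i * s j - if i = j then (s i : ℝ) else 0) =
      m * (m - 1) * (y i * y j - if i = j then (y i : ℝ) else 0) := by
  have hd (n : ℕ) : (n.descFactorial 2 : ℝ) = n * (n - 1) := by
    rw [Nat.cast_descFactorial_two]
  have h (s : ι → ℕ) : ∏ k, ((s k).descFactorial
      ((Pi.single i 1 + Pi.single j 1 : ι → ℕ) k) : ℝ) =
        s i * s j - if i = j then (s i : ℝ) else 0 := by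
    split_ifs with hij
    · subst hij
      rw [prod_eq_single i]
      · rw [Pi.add_apply, Pi.single_eq_same, hd]
        ring
      · simp +contextual
      · simp
    · rw [prod_eq_mul i j hij] <;> simp +contextual [hij, Ne.symm hij]
  have := sum_hypergeomProb_mul_descFactorial hm (Pi.single i 1 + Pi.single j 1)
  simp_rw [h] at this
  have h2 : ∑ k, (Pi.single i 1 + Pi.single j 1 : ι → ℕ) k = 2 := by
    simp [sum_add_distrib]
  rw [h2, hd, hd] at this
  exact this

/-- The mean of a linear statistic under the hypergeometric weights. -/
theorem sum_hypergeomProb_mul_linear (hm : m ≤ ∑ i, y i) (h0 : 0 < ∑ i, y i) (d : ι → ℝ) :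
    ∑ s ∈ piAntidiag univ m, hypergeomProb m y s * ∑ i, d i * s i =
      m / (∑ i, y i : ℕ) * ∑ i, d i * y i := by
  have hN : ((∑ i, y i : ℕ) : ℝ) ≠ 0 := by exact_mod_cast h0.ne'
  have h (i : ι) : ∑ s ∈ piAntidiag univ m, hypergeomProb m y s * s i =
      m / (∑ i, y i : ℕ) * y i := by
    rw [← mul_right_inj' hN, sum_hypergeomProb_mul hm]; field_simp
  simp_rw [mul_sum]
  rw [sum_comm]
  refine sum_congr rfl fun i _ ↦ ?_
  simp_rw [mul_left_comm _ (d i)]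
  rw [← mul_sum, h]

/-- The variance of a linear statistic under the hypergeometric weights. -/
theorem sum_hypergeomProb_mul_sq (hm : m ≤ ∑ i, y i) (h1 : 1 < ∑ i, y i) (d : ι → ℝ) :
    ∑ s ∈ piAntidiag univ m, hypergeomProb m y s *
        (∑ i, d i * s i - m / (∑ i, y i : ℕ) * ∑ i, d i * y i) ^ 2 =
      m * (∑ i, d i ^ 2 * (y i / (∑ i, y i : ℕ)) - (∑ i, d i * (y i / (∑ i, y i : ℕ))) ^ 2) -
      m * (m - 1) / ((∑ i, y i : ℕ) - 1) *
        (∑ i, d i ^ 2 * (y i / (∑ i, y i : ℕ)) - (∑ i, d i * (y i / (∑ i, y i : ℕ))) ^ 2) := by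
  have hN : ((∑ i, y i : ℕ) : ℝ) ≠ 0 := by exact_mod_cast (by omega)
  have hN1 : ((∑ i, y i : ℕ) : ℝ) - 1 ≠ 0 := by
    have : (1 : ℝ) < (∑ i, y i : ℕ) := by exact_mod_cast h1
    linarith
  have hmean := sum_hypergeomProb_mul_linear hm (by omega) d
  have hmean2 := sum_hypergeomProb_mul_linear hm (by omega) (fun i ↦ d i ^ 2)
  have hone := sum_hypergeomProb hm
  have hsq : ∑ s ∈ piAntidiag univ m, hypergeomProb m y s *
      ((∑ i, d i * s i) ^ 2 - ∑ i, d i ^ 2 * s i) =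
      m * (m - 1) / ((∑ i, y i : ℕ) * ((∑ i, y i : ℕ) - 1)) *
        ((∑ i, d i * y i) ^ 2 - ∑ i, d i ^ 2 * y i) := by
    have hexp (s : ι → ℕ) : (∑ i, d i * s i) ^ 2 - ∑ i, d i ^ 2 * s i =
        ∑ i, ∑ j, d i * d j * (s i * s j - if i = j then (s i : ℝ) else 0) := by
      simp only [mul_sub, sum_sub_distrib, mul_ite, mul_zero, sum_ite_eq, mem_univ, if_true]
      rw [sq, sum_mul_sum]
      congr 1
      · exact sum_congr rfl fun i _ ↦ sum_congr rfl fun j _ ↦ by ring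
      · exact sum_congr rfl fun i _ ↦ by ring
    have h (i j : ι) : ∑ s ∈ piAntidiag univ m, hypergeomProb m y s *
        (s i * s j - if i = j then (s i : ℝ) else 0) =
        m * (m - 1) / ((∑ i, y i : ℕ) * ((∑ i, y i : ℕ) - 1)) *
          (y i * y j - if i = j then (y i : ℝ) else 0) := by
      rw [← mul_right_inj' (mul_ne_zero hN hN1)]
      have := sum_hypergeomProb_mul_mul hm i j
      push_cast at this ⊢
      rw [this]
      push_cast at hN hN1
      field_simp
    simp_rw [hexp, mul_sum]
    rw [sum_comm]
    refine sum_congr rfl fun i _ ↦ ?_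
    rw [sum_comm]
    refine sum_congr rfl fun j _ ↦ ?_
    simp_rw [mul_left_comm _ (d i * d j)]
    rw [← mul_sum, h]
  set N : ℝ := ((∑ i, y i : ℕ) : ℝ)
  set c : ℝ := m / N * ∑ i, d i * y i with hc
  have hsplit : ∑ s ∈ piAntidiag univ m, hypergeomProb m y s * (∑ i, d i * s i - c) ^ 2 =
      ∑ s ∈ piAntidiag univ m, hypergeomProb m y s * ((∑ i, d i * s i) ^ 2 - ∑ i, d i ^ 2 * s i) +
      ∑ s ∈ piAntidiag univ m, hypergeomProb m y s * (∑ i, d i ^ 2 * s i) -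
      2 * c * ∑ s ∈ piAntidiag univ m, hypergeomProb m y s * (∑ i, d i * s i) +
      c ^ 2 * ∑ s ∈ piAntidiag univ m, hypergeomProb m y s := by
    simp only [mul_sum (s := piAntidiag univ m), ← sum_add_distrib, ← sum_sub_distrib]
    exact sum_congr rfl fun s _ ↦ by ring
  have hdiv (e : ι → ℝ) : ∑ i, e i * (y i / N) = (∑ i, e i * y i) / N := by
    rw [sum_div]; exact sum_congr rfl fun i _ ↦ by ring
  rw [hsplit, hsq, hmean, hmean2, hone, hdiv, hdiv, hc]
  field_simp
  ring

end Hypergeometric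

/-- The facts about the law of the containment profile used in the limit theorem: the total
population is deterministic, and the one-step transition law is the hypergeometric one. -/
structure IsProfileProcess {Ω : Type*} {m0 : MeasurableSpace Ω} (μ : Measure Ω) (θ : ℕ)
    (Y : ℕ → Ω → Fin 4 → ℕ) : Prop where
  measurable : ∀ n, Measurable (Y n)
  zero : ∀ ω, Y 0 ω = ![θ, 0, 0, 0]
  sum_eq : ∀ n, ∀ᵐ ω ∂μ, ∑ j, Y n ω j = n + θ
  integral_succ : ∀ n (g : (Fin 4 → ℤ) → ℂ),
    ∫ ω, g (fun j ↦ Y (n + 1) ω j) ∂μ =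
      ∫ ω, ∑ s ∈ piAntidiag univ (θ - 1),
        hypergeomProb (θ - 1) (Y n ω) s • g (fun j ↦ Y n ω j + replVecZ3 s j) ∂μ

theorem integrable_comp_of_ae_sum_eq {Ω : Type*} {m0 : MeasurableSpace Ω} {μ : Measure Ω}
    [IsFiniteMeasure μ] {ι E : Type*} [Fintype ι] [NormedAddCommGroup E]
    {X : Ω → ι → ℕ} (hX : Measurable X) {N : ℕ} (hN : ∀ᵐ ω ∂μ, ∑ j, X ω j = N)
    (g : (ι → ℕ) → E) : Integrable (fun ω ↦ g (X ω)) μ := by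
  classical
  have hg : StronglyMeasurable g := .of_discrete
  refine Integrable.of_bound (hg.comp_measurable hX).aestronglyMeasurable
    (∑ y ∈ piAntidiag univ N, ‖g y‖) ?_
  filter_upwards [hN] with ω hω
  exact single_le_sum (f := fun y ↦ ‖g y‖) (fun _ _ ↦ norm_nonneg _) (by simp [hω])

theorem replVecZ3_injOn (m : ℕ) :
    Set.InjOn replVecZ3 (piAntidiag (univ : Finset (Fin 4)) m : Set (Fin 4 → ℕ)) := by
  intro s hs t ht h
  have h0 := congrFun h 0
  have h1 := congrFun h 1
  have h2 := congrFun h 2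
  simp [replVecZ3] at h0 h1 h2
  simp [Fin.sum_univ_four] at hs ht
  funext j
  fin_cases j <;> simp <;> omega

theorem sum_replVecZ3 (s : Fin 4 → ℕ) : ∑ j, replVecZ3 s j = 1 := by
  simp [replVecZ3, Fin.sum_univ_four]

theorem isProfileProcess_of_condExp
    {Ω : Type*} {m0 : MeasurableSpace Ω} {μ : Measure Ω} [IsProbabilityMeasure μ]
    (θ : ℕ) (hθ : 2 ≤ θ)
    (F : ℕ → MeasurableSpace Ω) (hFle : ∀ n, F n ≤ m0)
    (Y : ℕ → Ω → Fin 4 → ℕ)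
    (hYadapted : ∀ n, Measurable[F n] (Y n))
    (hY0 : ∀ ω, Y 0 ω = ![θ, 0, 0, 0])
    (hcond : ∀ n, 1 ≤ n → ∀ s : Fin 4 → ℕ, (∑ i, s i = θ - 1) →
      (μ[(fun ω => if (∀ j : Fin 4,
            (Y n ω j : ℤ) = (Y (n - 1) ω j : ℤ) + replVecZ3 s j)
          then (1 : ℝ) else 0) | F (n - 1)]) =ᵐ[μ]
        (fun ω => (∏ j, ((Y (n - 1) ω j).choose (s j) : ℝ)) /
          ((n - 1 + θ).choose (θ - 1) : ℝ))) :
    IsProfileProcess μ θ Y := by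
  classical
  have hmeas (n : ℕ) : Measurable (Y n) := (hYadapted n).mono (hFle n) le_rfl
  set Δ : Finset (Fin 4 → ℕ) := piAntidiag univ (θ - 1)
  set b : ℕ → (Fin 4 → ℕ) → Ω → ℝ := fun n s ω ↦
    if ∀ j, (Y (n + 1) ω j : ℤ) = (Y n ω j : ℤ) + replVecZ3 s j then 1 else 0 with hb
  have hb_meas (n : ℕ) (s) : Measurable (b n s) := by
    have hm : MeasurableSet
        {p : (Fin 4 → ℕ) × (Fin 4 → ℕ) | ∀ j, (p.1 j : ℤ) = p.2 j + replVecZ3 s j} :=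
      MeasurableSet.of_discrete
    exact Measurable.ite (((hmeas (n + 1)).prodMk (hmeas n)) hm) measurable_const measurable_const
  have hb_norm (n : ℕ) (s ω) : ‖b n s ω‖ ≤ 1 := by
    simp only [hb]; split_ifs <;> simp
  have hb_int (n : ℕ) (s) : Integrable (b n s) μ :=
    Integrable.of_bound (hb_meas n s).aestronglyMeasurable 1 (.of_forall (hb_norm n s))
  have hpull (n : ℕ) (hn : ∀ᵐ ω ∂μ, ∑ j, Y n ω j = n + θ) (s) (hs : s ∈ Δ)
      (G : (Fin 4 → ℕ) → ℂ) :
      ∫ ω, b n s ω • G (Y n ω) ∂μ = ∫ ω, hypergeomProb (θ - 1) (Y n ω) s • G (Y n ω) ∂μ := by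
    have hG : StronglyMeasurable[F n] (fun ω ↦ G (Y n ω)) :=
      (StronglyMeasurable.of_discrete (f := G)).comp_measurable (hYadapted n)
    have hGint := integrable_comp_of_ae_sum_eq (hmeas n) hn G
    have h := condExp_smul_of_aestronglyMeasurable_right (m := F n) (hb_int n s)
      (hGint.bdd_smul (𝕜 := ℝ) 1 (hb_meas n s).aestronglyMeasurable (.of_forall (hb_norm n s)))
      hG.aestronglyMeasurable
    have hc := hcond (n + 1) (by omega) s (by simpa [Δ] using hs)
    simp only [Nat.add_sub_cancel] at hc
    calc ∫ ω, b n s ω • G (Y n ω) ∂μ = ∫ ω, (μ[b n s • (fun ω ↦ G (Y n ω)) | F n]) ω ∂μ :=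
          (integral_condExp (hFle n)).symm
      _ = ∫ ω, hypergeomProb (θ - 1) (Y n ω) s • G (Y n ω) ∂μ := by
          refine integral_congr_ae ?_
          filter_upwards [h, hc, hn] with ω h1 h2 h3
          rw [h1, Pi.smul_apply', h2, hypergeomProb, h3]
  have hb_sum (n : ℕ) (hn : ∀ᵐ ω ∂μ, ∑ j, Y n ω j = n + θ) :
      ∀ᵐ ω ∂μ, ∑ s ∈ Δ, b n s ω = 1 := by
    have hle (ω) : ∑ s ∈ Δ, b n s ω ≤ 1 := by
      simp only [hb, sum_boole]
      norm_cast
      refine card_le_one.2 fun s hs t ht ↦ ?_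
      simp only [mem_filter] at hs ht
      refine replVecZ3_injOn (θ - 1) hs.1 ht.1 (funext fun j ↦ ?_)
      have := hs.2 j
      have := ht.2 j
      omega
    have hint : ∫ ω, ∑ s ∈ Δ, b n s ω ∂μ = 1 := by
      have h1 (s) (hs : s ∈ Δ) :
          ∫ ω, b n s ω ∂μ = ∫ ω, hypergeomProb (θ - 1) (Y n ω) s ∂μ := by
        have := hpull n hn s hs (fun _ ↦ 1)
        simp only [Complex.real_smul, mul_one, integral_complex_ofReal] at this
        exact_mod_cast this
      rw [integral_finsetSum _ fun s _ ↦ hb_int n s, sum_congr rfl h1, ← integral_finsetSum]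
      · rw [integral_congr_ae (g := fun _ ↦ (1 : ℝ)), integral_const]
        · simp
        filter_upwards [hn] with ω hω
        exact sum_hypergeomProb (by omega)
      · exact fun s _ ↦ integrable_comp_of_ae_sum_eq (hmeas n) hn (hypergeomProb (θ - 1) · s)
    have hint' : Integrable (fun ω ↦ ∑ s ∈ Δ, b n s ω) μ :=
      integrable_finsetSum _ fun s _ ↦ hb_int n s
    have h0 : ∫ ω, (1 - ∑ s ∈ Δ, b n s ω) ∂μ = 0 := by
      rw [integral_sub (integrable_const _) hint', hint]; simp
    rw [integral_eq_zero_iff_of_nonneg (fun ω ↦ sub_nonneg.2 (hle ω))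
      ((integrable_const _).sub hint')] at h0
    filter_upwards [h0] with ω hω
    simp at hω
    linarith
  have hsum (n : ℕ) : ∀ᵐ ω ∂μ, ∑ j, Y n ω j = n + θ := by
    induction n with
    | zero => exact .of_forall fun ω ↦ by simp [hY0, Fin.sum_univ_four]
    | succ n ih =>
      filter_upwards [ih, hb_sum n ih] with ω h1 h2
      obtain ⟨s, -, hs⟩ := exists_ne_zero_of_sum_ne_zero (h2.trans_ne one_ne_zero)
      have hs : ∀ j, (Y (n + 1) ω j : ℤ) = (Y n ω j : ℤ) + replVecZ3 s j := by
        by_contra h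
        exact hs (if_neg h)
      zify at h1 ⊢
      simp_rw [hs, sum_add_distrib, sum_replVecZ3, h1]
      ring
  refine ⟨hmeas, hY0, hsum, fun n g ↦ ?_⟩
  have hG (s : Fin 4 → ℕ) := integrable_comp_of_ae_sum_eq (hmeas n) (hsum n)
    (fun y ↦ g (fun j ↦ y j + replVecZ3 s j))
  calc ∫ ω, g (fun j ↦ Y (n + 1) ω j) ∂μ
      = ∫ ω, ∑ s ∈ Δ, b n s ω • g (fun j ↦ Y n ω j + replVecZ3 s j) ∂μ := by
        refine integral_congr_ae ?_
        filter_upwards [hb_sum n (hsum n)] with ω hω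
        rw [← one_smul ℝ (g fun j ↦ (Y (n + 1) ω j : ℤ)), ← hω, sum_smul]
        refine sum_congr rfl fun s _ ↦ ?_
        by_cases h : ∀ j, (Y (n + 1) ω j : ℤ) = (Y n ω j : ℤ) + replVecZ3 s j
        · simp_rw [h]
        · simp [hb, if_neg h]
    _ = _ := by
        rw [integral_finsetSum, integral_finsetSum]
        · exact sum_congr rfl fun s hs ↦
            hpull n (hsum n) s hs (fun y ↦ g (fun j ↦ y j + replVecZ3 s j))
        · exact fun s _ ↦ integrable_comp_of_ae_sum_eq (hmeas n) (hsum n)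
            (fun y ↦ hypergeomProb (θ - 1) y s • g (fun j ↦ y j + replVecZ3 s j))
        · exact fun s _ ↦ (hG s).bdd_smul (𝕜 := ℝ) 1 (hb_meas n s).aestronglyMeasurable
            (.of_forall (hb_norm n s))

theorem IsProfileProcess.integrable {Ω : Type*} {m0 : MeasurableSpace Ω} {μ : Measure Ω}
    [IsProbabilityMeasure μ] {θ : ℕ} {Y : ℕ → Ω → Fin 4 → ℕ} (hY : IsProfileProcess μ θ Y)
    {E : Type*} [NormedAddCommGroup E] (n : ℕ) (g : (Fin 4 → ℕ) → E) :
    Integrable (fun ω ↦ g (Y n ω)) μ :=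
  integrable_comp_of_ae_sum_eq (hY.measurable n) (hY.sum_eq n) g

theorem IsProfileProcess.integral_succ_real {Ω : Type*} {m0 : MeasurableSpace Ω} {μ : Measure Ω}
    {θ : ℕ} {Y : ℕ → Ω → Fin 4 → ℕ} (hY : IsProfileProcess μ θ Y)
    (n : ℕ) (g : (Fin 4 → ℤ) → ℝ) :
    ∫ ω, g (fun j ↦ Y (n + 1) ω j) ∂μ =
      ∫ ω, ∑ s ∈ piAntidiag univ (θ - 1),
        hypergeomProb (θ - 1) (Y n ω) s * g (fun j ↦ Y n ω j + replVecZ3 s j) ∂μ := by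
  have h := hY.integral_succ n (fun y ↦ (g y : ℂ))
  simp only [Complex.real_smul, ← Complex.ofReal_mul, ← Complex.ofReal_sum,
    integral_complex_ofReal] at h
  exact_mod_cast h

/-- The asymptotic mean proportions of the first three containment levels. -/
noncomputable def profileMean (θ : ℕ) (i : Fin 3) : ℝ :=
  ((θ : ℝ) - 1) ^ i.val / (θ : ℝ) ^ (i.val + 1)

/-- The increment functional `t · a_s = t 0 + ∑ j, profileDiff t j * s j`. -/
def profileDiff (t : Fin 3 → ℝ) : Fin 4 → ℝ := ![t 1 - t 0, t 2 - t 1, -t 2, 0]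

/-- The transpose of the one-step conditional mean operator, with rate `c`. -/
def profileShift (c : ℝ) (t : Fin 3 → ℝ) : Fin 3 → ℝ :=
  fun i ↦ t i + c * profileDiff t i.castSucc

/-- The centred linear statistic of the profile in direction `t`. -/
noncomputable def profileDev (θ n : ℕ) (y : Fin 4 → ℤ) (t : Fin 3 → ℝ) : ℝ :=
  ∑ i : Fin 3, t i * (y i.castSucc - (n + θ) * profileMean θ i)

/-- The centred one-step increment of a linear statistic when the sample is `s`. -/
noncomputable def profileFluct (θ : ℕ) (y s : Fin 4 → ℕ) (t : Fin 3 → ℝ) : ℝ :=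
  ∑ j, profileDiff t j * s j -
    ((θ - 1 : ℕ) : ℝ) / (∑ j, y j : ℕ) * ∑ j, profileDiff t j * y j

/-- The limiting one-step conditional variance of a linear statistic. -/
noncomputable def profileVar (θ : ℕ) (t : Fin 3 → ℝ) : ℝ :=
  ((θ - 1 : ℕ) : ℝ) * (∑ i : Fin 3, profileDiff t i.castSucc ^ 2 * profileMean θ i -
    (∑ i : Fin 3, profileDiff t i.castSucc * profileMean θ i) ^ 2)

theorem profileMean_nonneg {θ : ℕ} (hθ : 1 ≤ θ) (i : Fin 3) : 0 ≤ profileMean θ i := by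
  have : (1 : ℝ) ≤ θ := by exact_mod_cast hθ
  have : 0 ≤ (θ : ℝ) - 1 := by linarith
  unfold profileMean
  positivity

theorem sum_profileMean_le_one {θ : ℕ} (hθ : 1 ≤ θ) : ∑ i, profileMean θ i ≤ 1 := by
  have h1 : (1 : ℝ) ≤ θ := by exact_mod_cast hθ
  have h : ∑ i, profileMean θ i = 1 - (((θ : ℝ) - 1) / θ) ^ 3 := by
    simp only [profileMean, Fin.sum_univ_three, Fin.coe_ofNat_eq_mod]
    field_simp
    ring
  have : 0 ≤ (((θ : ℝ) - 1) / θ) ^ 3 := pow_nonneg (div_nonneg (by linarith) (by linarith)) 3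
  linarith

theorem abs_profileDiff_le (t : Fin 3 → ℝ) (j : Fin 4) : |profileDiff t j| ≤ 2 * ‖t‖ := by
  have h (i) : |t i| ≤ ‖t‖ := norm_le_pi_norm t i
  have h0 := abs_le.1 (h 0)
  have h1 := abs_le.1 (h 1)
  have h2 := abs_le.1 (h 2)
  fin_cases j <;> simp [profileDiff, abs_le] <;> (try constructor) <;> linarith

theorem abs_sum_profileDiff_mul_le {ι : Type*} (u : Finset ι) (t : Fin 3 → ℝ) (e : ι → Fin 4)
    (x : ι → ℝ) : |∑ i ∈ u, profileDiff t (e i) * x i| ≤ 2 * ‖t‖ * ∑ i ∈ u, |x i| := by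
  rw [mul_sum]
  refine (abs_sum_le_sum_abs _ _).trans (sum_le_sum fun i _ ↦ ?_)
  rw [abs_mul]
  exact mul_le_mul_of_nonneg_right (abs_profileDiff_le t _) (abs_nonneg _)

theorem abs_sum_sq_profileDiff_mul_le {ι : Type*} (u : Finset ι) (t : Fin 3 → ℝ) (e : ι → Fin 4)
    (x : ι → ℝ) : |∑ i ∈ u, profileDiff t (e i) ^ 2 * x i| ≤ 4 * ‖t‖ ^ 2 * ∑ i ∈ u, |x i| := by
  rw [mul_sum]
  refine (abs_sum_le_sum_abs _ _).trans (sum_le_sum fun i _ ↦ ?_)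
  rw [abs_mul, abs_pow]
  refine mul_le_mul_of_nonneg_right ?_ (abs_nonneg _)
  calc |profileDiff t (e i)| ^ 2 ≤ (2 * ‖t‖) ^ 2 := by
        gcongr; exact abs_profileDiff_le t _
    _ = 4 * ‖t‖ ^ 2 := by ring

theorem norm_profileShift_le {c : ℝ} (h0 : 0 ≤ c) (h1 : c ≤ 1) (t : Fin 3 → ℝ) :
    ‖profileShift c t‖ ≤ ‖t‖ := by
  have h (i) : |t i| ≤ ‖t‖ := norm_le_pi_norm t i
  have ha := abs_le.1 (h 0)
  have hb := abs_le.1 (h 1)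
  have hd := abs_le.1 (h 2)
  refine (pi_norm_le_iff_of_nonneg (norm_nonneg t)).2 fun i ↦ ?_
  rw [Real.norm_eq_abs, abs_le]
  fin_cases i <;> simp [profileShift, profileDiff] <;> constructor <;> nlinarith

theorem profileDev_succ {θ : ℕ} (hθ : 1 ≤ θ) (n : ℕ) (y s : Fin 4 → ℕ) (hy : ∑ j, y j = n + θ)
    (t : Fin 3 → ℝ) :
    profileDev θ (n + 1) (fun j ↦ y j + replVecZ3 s j) t =
      profileDev θ n (fun j ↦ y j)
        (profileShift (((θ - 1 : ℕ) : ℝ) / (∑ j, y j : ℕ)) t) + profileFluct θ y s t := by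
  have h0 : (θ : ℝ) ≠ 0 := by positivity
  have hN : ((n : ℝ) + θ) ≠ 0 := by positivity
  simp only [profileDev, profileFluct, hy, profileShift, profileDiff, replVecZ3, profileMean,
    Fin.sum_univ_three, Fin.sum_univ_four]
  push_cast [hθ]
  simp
  field_simp
  ring

theorem abs_profileFluct_le {θ : ℕ} (y s : Fin 4 → ℕ)
    (hs : ∑ j, s j = θ - 1) (t : Fin 3 → ℝ) : |profileFluct θ y s t| ≤ 4 * θ * ‖t‖ := by
  have h1 := abs_sum_profileDiff_mul_le univ t id (fun j ↦ (s j : ℝ))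
  have h2 := abs_sum_profileDiff_mul_le univ t id (fun j ↦ (y j : ℝ))
  have hθ : ((θ - 1 : ℕ) : ℝ) ≤ θ := by exact_mod_cast Nat.sub_le _ _
  simp only [Nat.abs_cast, ← Nat.cast_sum, hs, id] at h1 h2
  have h3 : |((θ - 1 : ℕ) : ℝ) / (∑ j, y j : ℕ) * ∑ j, profileDiff t j * y j| ≤
      2 * ‖t‖ * (θ - 1 : ℕ) := by
    rw [abs_mul, abs_of_nonneg (by positivity)]
    rcases Nat.eq_zero_or_pos (∑ j, y j) with h | h
    · rw [h]; simp; positivity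
    · have h' : (0 : ℝ) < (∑ j, y j : ℕ) := by exact_mod_cast h
      calc _ ≤ ((θ - 1 : ℕ) : ℝ) / (∑ j, y j : ℕ) * (2 * ‖t‖ * (∑ j, y j : ℕ)) := by gcongr
        _ = 2 * ‖t‖ * (θ - 1 : ℕ) := by field_simp
  refine (abs_sub _ _).trans ((add_le_add h1 h3).trans ?_)
  nlinarith [norm_nonneg t]

theorem profileVar_nonneg {θ : ℕ} (hθ : 1 ≤ θ) (t : Fin 3 → ℝ) : 0 ≤ profileVar θ t := by
  refine mul_nonneg (Nat.cast_nonneg _) (sub_nonneg.2 ?_)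
  have hcs := sum_mul_sq_le_sq_mul_sq univ
    (fun i : Fin 3 ↦ profileDiff t i.castSucc * √(profileMean θ i)) (fun i ↦ √(profileMean θ i))
  simp only [mul_pow, mul_assoc, Real.mul_self_sqrt (profileMean_nonneg hθ _),
    Real.sq_sqrt (profileMean_nonneg hθ _)] at hcs
  refine hcs.trans (mul_le_of_le_one_right ?_ (sum_profileMean_le_one hθ))
  exact sum_nonneg fun i _ ↦ mul_nonneg (sq_nonneg _) (profileMean_nonneg hθ i)

theorem profileVar_le {θ : ℕ} (hθ : 1 ≤ θ) (t : Fin 3 → ℝ) :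
    profileVar θ t ≤ 4 * θ * ‖t‖ ^ 2 := by
  have h := abs_sum_sq_profileDiff_mul_le univ t Fin.castSucc (profileMean θ)
  simp only [abs_of_nonneg (profileMean_nonneg hθ _)] at h
  have h1 := (le_abs_self _).trans h
  have h2 := sum_profileMean_le_one hθ
  have hm : ((θ - 1 : ℕ) : ℝ) ≤ θ := by exact_mod_cast Nat.sub_le _ _
  calc profileVar θ t ≤ ((θ - 1 : ℕ) : ℝ) * (4 * ‖t‖ ^ 2) := by
        refine mul_le_mul_of_nonneg_left ?_ (Nat.cast_nonneg _)
        nlinarith [sq_nonneg (∑ i : Fin 3, profileDiff t i.castSucc * profileMean θ i),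
          sq_nonneg ‖t‖]
    _ ≤ θ * (4 * ‖t‖ ^ 2) := by gcongr
    _ = 4 * θ * ‖t‖ ^ 2 := by ring

/-- The conditional variance is close to its limit when the proportions are close to theirs. -/
theorem abs_sum_hypergeomProb_mul_sq_profileFluct_sub_le {θ : ℕ} (hθ : 1 ≤ θ) (y : Fin 4 → ℕ)
    (hy : θ ≤ ∑ j, y j) (hy1 : 1 < ∑ j, y j) (t : Fin 3 → ℝ) :
    |∑ s ∈ piAntidiag univ (θ - 1), hypergeomProb (θ - 1) y s * profileFluct θ y s t ^ 2 -
        profileVar θ t| ≤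
      20 * θ ^ 2 * ‖t‖ ^ 2 * (∑ i : Fin 3,
        |(y i.castSucc : ℝ) / (∑ j, y j : ℕ) - profileMean θ i| + 1 / (∑ j, y j : ℕ)) := by
  have hm : θ - 1 ≤ ∑ j, y j := by omega
  simp only [profileFluct]
  rw [sum_hypergeomProb_mul_sq hm hy1, profileVar]
  set N : ℝ := ((∑ j, y j : ℕ) : ℝ) with hN
  have hN2 : (2 : ℝ) ≤ N := by rw [hN]; exact_mod_cast hy1
  set x : Fin 4 → ℝ := fun i ↦ (y i : ℝ) / N with hx
  have hx0 (i) : 0 ≤ x i := by rw [hx]; positivity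
  have hxsum : ∑ i, x i = 1 := by
    rw [hx, ← sum_div, div_eq_one_iff_eq (by linarith), hN]; push_cast; rfl
  have hsplit (f : ℝ → ℝ) (hf : f 0 = 0) : ∑ i, f (profileDiff t i) * x i =
      ∑ i : Fin 3, f (profileDiff t i.castSucc) * x i.castSucc := by
    have : profileDiff t (Fin.last 3) = 0 := rfl
    rw [Fin.sum_univ_castSucc, this, hf]; ring
  have ha := abs_sum_sq_profileDiff_mul_le univ t id x
  have hb := abs_sum_profileDiff_mul_le univ t id x
  have hb' := abs_sum_profileDiff_mul_le univ t Fin.castSucc (profileMean θ)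
  have hda := abs_sum_sq_profileDiff_mul_le univ t Fin.castSucc
    (fun i ↦ x i.castSucc - profileMean θ i)
  have hdb := abs_sum_profileDiff_mul_le univ t Fin.castSucc
    (fun i ↦ x i.castSucc - profileMean θ i)
  simp only [abs_of_nonneg (hx0 _), abs_of_nonneg (profileMean_nonneg hθ _), hxsum, id,
    mul_one] at ha hb hb'
  simp only [mul_sub, sum_sub_distrib] at hda hdb
  rw [← hsplit (fun z ↦ z ^ 2) (by simp)] at hda
  rw [← hsplit (fun z ↦ z) rfl] at hdb
  replace hb' := hb'.trans (mul_le_of_le_one_right (by positivity) (sum_profileMean_le_one hθ))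
  set a := ∑ i, profileDiff t i ^ 2 * x i
  set b := ∑ i, profileDiff t i * x i
  set a' := ∑ i : Fin 3, profileDiff t i.castSucc ^ 2 * profileMean θ i
  set b' := ∑ i : Fin 3, profileDiff t i.castSucc * profileMean θ i
  set S := ∑ i : Fin 3, |x i.castSucc - profileMean θ i|
  have hS : 0 ≤ S := sum_nonneg fun _ _ ↦ abs_nonneg _
  set m : ℝ := ((θ - 1 : ℕ) : ℝ)
  have hm0 : 0 ≤ m := Nat.cast_nonneg _
  have hmθ : m ≤ θ := by simp only [m]; exact_mod_cast Nat.sub_le _ _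
  have hθ1 : (1 : ℝ) ≤ θ := by exact_mod_cast hθ
  have h0 := norm_nonneg t
  have hbsq : b ^ 2 ≤ 4 * ‖t‖ ^ 2 := by
    rw [← sq_abs]; nlinarith [abs_nonneg b]
  have e1 : |m * (a - a')| ≤ θ * (4 * ‖t‖ ^ 2 * S) := by
    rw [abs_mul, abs_of_nonneg hm0]; gcongr
  have e2 : |m * ((b - b') * (b + b'))| ≤ θ * ((2 * ‖t‖ * S) * (4 * ‖t‖)) := by
    rw [abs_mul, abs_of_nonneg hm0, abs_mul]
    gcongr
    exact (abs_add_le _ _).trans (by linarith)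
  have e3 : |m * (m - 1) / (N - 1) * (a - b ^ 2)| ≤ 2 * θ ^ 2 / N * (8 * ‖t‖ ^ 2) := by
    rw [abs_mul]
    have hcoef : |m * (m - 1) / (N - 1)| ≤ 2 * θ ^ 2 / N := by
      rw [abs_div, abs_of_pos (by linarith : 0 < N - 1), div_le_div_iff₀ (by linarith)
        (by linarith), abs_mul, abs_of_nonneg hm0]
      have : |m - 1| ≤ θ := abs_le.2 ⟨by linarith, by linarith⟩
      calc m * |m - 1| * N ≤ θ * θ * N := by gcongr
        _ ≤ 2 * θ ^ 2 * (N - 1) := by nlinarith [sq_nonneg (θ : ℝ)]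
    gcongr
    refine (abs_sub _ _).trans ?_
    rw [abs_of_nonneg (sq_nonneg b)]
    linarith
  have heq : m * (a - b ^ 2) - m * (m - 1) / (N - 1) * (a - b ^ 2) - m * (a' - b' ^ 2) =
      m * (a - a') - m * ((b - b') * (b + b')) - m * (m - 1) / (N - 1) * (a - b ^ 2) := by ring
  rw [heq]
  refine (abs_sub _ _).trans ((add_le_add ((abs_sub _ _).trans (add_le_add e1 e2)) e3).trans ?_)
  have h1 : (θ : ℝ) * (4 * ‖t‖ ^ 2 * S) + θ * ((2 * ‖t‖ * S) * (4 * ‖t‖)) =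
      12 * (θ * (‖t‖ ^ 2 * S)) := by ring
  have h2 : 20 * (θ : ℝ) ^ 2 * ‖t‖ ^ 2 * (S + 1 / N) =
      20 * (θ * (θ * (‖t‖ ^ 2 * S))) + 20 * (θ ^ 2 / N * ‖t‖ ^ 2) := by ring
  have h3 : 2 * (θ : ℝ) ^ 2 / N * (8 * ‖t‖ ^ 2) = 16 * (θ ^ 2 / N * ‖t‖ ^ 2) := by ring
  have h4 : (θ : ℝ) * (‖t‖ ^ 2 * S) ≤ θ * (θ * (‖t‖ ^ 2 * S)) :=
    le_mul_of_one_le_left (by positivity) hθ1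
  have h5 : 0 ≤ (θ : ℝ) * (‖t‖ ^ 2 * S) := by positivity
  have h6 : 0 ≤ (θ : ℝ) ^ 2 / N * ‖t‖ ^ 2 := by positivity
  rw [h1, h2, h3]
  linarith

theorem profileDev_zero {Ω : Type*} {m0 : MeasurableSpace Ω} {μ : Measure Ω} {θ : ℕ}
    {Y : ℕ → Ω → Fin 4 → ℕ} (hθ : 1 ≤ θ) (hY : IsProfileProcess μ θ Y) (t : Fin 3 → ℝ)
    (ω : Ω) :
    |profileDev θ 0 (fun j ↦ Y 0 ω j) t| ≤ 2 * θ * ‖t‖ := by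
  have hθ1 : (1 : ℝ) ≤ θ := by exact_mod_cast hθ
  have hb (i : Fin 3) : |((Y 0 ω i.castSucc : ℤ) : ℝ) - ((0 : ℕ) + θ) * profileMean θ i| ≤
      (Y 0 ω i.castSucc : ℝ) + θ * profileMean θ i := by
    refine (abs_sub _ _).trans (le_of_eq ?_)
    rw [abs_of_nonneg (by simp), abs_of_nonneg]
    · simp
    · have := profileMean_nonneg hθ i; positivity
  calc _ ≤ ∑ i : Fin 3, ‖t‖ * ((Y 0 ω i.castSucc : ℝ) + θ * profileMean θ i) := by
        refine (abs_sum_le_sum_abs _ _).trans (sum_le_sum fun i _ ↦ ?_)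
        rw [abs_mul]
        exact mul_le_mul (norm_le_pi_norm t i) (hb i) (abs_nonneg _) (norm_nonneg _)
    _ = ‖t‖ * (θ + θ * ∑ i, profileMean θ i) := by
        rw [← mul_sum, sum_add_distrib, ← mul_sum]
        simp [hY.zero, Fin.sum_univ_three]
    _ ≤ ‖t‖ * (θ + θ * 1) := by gcongr; exact sum_profileMean_le_one hθ
    _ = _ := by ring

section Moments

variable {Ω : Type*} {m0 : MeasurableSpace Ω} {μ : Measure Ω} [IsProbabilityMeasure μ] {θ : ℕ}
  {Y : ℕ → Ω → Fin 4 → ℕ}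

theorem sum_hypergeomProb_mul_profileFluct (y : Fin 4 → ℕ)
    (hy : θ - 1 ≤ ∑ j, y j) (hy0 : 0 < ∑ j, y j) (t : Fin 3 → ℝ) :
    ∑ s ∈ piAntidiag univ (θ - 1), hypergeomProb (θ - 1) y s * profileFluct θ y s t = 0 := by
  simp only [profileFluct, mul_sub, sum_sub_distrib]
  rw [sum_hypergeomProb_mul_linear hy hy0, ← sum_mul, sum_hypergeomProb hy]
  ring

theorem sum_hypergeomProb_mul_sq_profileFluct_le (y : Fin 4 → ℕ)
    (hy : θ - 1 ≤ ∑ j, y j) (t : Fin 3 → ℝ) :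
    ∑ s ∈ piAntidiag univ (θ - 1), hypergeomProb (θ - 1) y s * profileFluct θ y s t ^ 2 ≤
      16 * θ ^ 2 * ‖t‖ ^ 2 := by
  calc _ ≤ ∑ s ∈ piAntidiag univ (θ - 1), hypergeomProb (θ - 1) y s * (16 * θ ^ 2 * ‖t‖ ^ 2) := by
        refine sum_le_sum fun s hs ↦
          mul_le_mul_of_nonneg_left ?_ (hypergeomProb_nonneg s)
        have := abs_profileFluct_le y s (θ := θ) (by simpa using hs) t
        rw [← sq_abs]
        calc _ ≤ (4 * θ * ‖t‖) ^ 2 := by gcongr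
          _ = _ := by ring
    _ = _ := by rw [← sum_mul, sum_hypergeomProb hy, one_mul]

theorem IsProfileProcess.integral_sq_profileDev_le (hθ : 1 ≤ θ) (hY : IsProfileProcess μ θ Y)
    (n : ℕ) (t : Fin 3 → ℝ) :
    ∫ ω, profileDev θ n (fun j ↦ Y n ω j) t ^ 2 ∂μ ≤ 16 * θ ^ 2 * (n + θ) * ‖t‖ ^ 2 := by
  have hθ1 : (1 : ℝ) ≤ θ := by exact_mod_cast hθ
  induction n generalizing t with
  | zero =>
    calc _ ≤ ∫ ω, (2 * θ * ‖t‖) ^ 2 ∂μ := by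
          refine integral_mono (hY.integrable 0 fun y ↦ profileDev θ 0 (fun j ↦ y j) t ^ 2)
            (integrable_const _) fun ω ↦ ?_
          dsimp only
          rw [← sq_abs]
          gcongr
          exact profileDev_zero hθ hY t ω
      _ = 4 * θ ^ 2 * 1 * ‖t‖ ^ 2 := by simp; ring
      _ ≤ _ := by push_cast; gcongr <;> linarith
  | succ n ih =>
    rw [hY.integral_succ_real n (fun y ↦ profileDev θ (n + 1) y t ^ 2)]
    set c : ℝ := ((θ - 1 : ℕ) : ℝ) / (n + θ : ℕ) with hc
    have hc0 : 0 ≤ c := by positivity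
    have hc1 : c ≤ 1 := div_le_one_of_le₀ (by exact_mod_cast (by omega)) (by positivity)
    calc _ ≤ ∫ ω, (profileDev θ n (fun j ↦ Y n ω j) (profileShift c t) ^ 2 +
            16 * θ ^ 2 * ‖t‖ ^ 2) ∂μ := by
          refine integral_mono_ae (hY.integrable n fun y ↦ ∑ s ∈ piAntidiag univ (θ - 1),
            hypergeomProb (θ - 1) y s * profileDev θ (n + 1) (fun j ↦ y j + replVecZ3 s j) t ^ 2)
            ((hY.integrable n fun y ↦ profileDev θ n (fun j ↦ y j)
              (profileShift c t) ^ 2).add (integrable_const _)) ?_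
          filter_upwards [hY.sum_eq n] with ω hω
          simp_rw [profileDev_succ hθ n _ _ hω]
          have h1 := sum_hypergeomProb (m := θ - 1) (y := Y n ω) (by omega)
          have h2 := sum_hypergeomProb_mul_profileFluct (θ := θ) (Y n ω) (by omega) (by omega) t
          have h3 := sum_hypergeomProb_mul_sq_profileFluct_le (θ := θ) (Y n ω) (by omega) t
          rw [hω, ← hc]
          set w := profileDev θ n (fun j ↦ Y n ω j) (profileShift c t)
          calc _ = w ^ 2 * ∑ s ∈ piAntidiag univ (θ - 1), hypergeomProb (θ - 1) (Y n ω) s +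
                2 * w * ∑ s ∈ piAntidiag univ (θ - 1),
                  hypergeomProb (θ - 1) (Y n ω) s * profileFluct θ (Y n ω) s t +
                ∑ s ∈ piAntidiag univ (θ - 1),
                  hypergeomProb (θ - 1) (Y n ω) s * profileFluct θ (Y n ω) s t ^ 2 := by
                simp only [mul_sum, ← sum_add_distrib]
                exact sum_congr rfl fun s _ ↦ by ring
            _ ≤ _ := by rw [h1, h2]; linarith
      _ = ∫ ω, profileDev θ n (fun j ↦ Y n ω j) (profileShift c t) ^ 2 ∂μ +
            16 * θ ^ 2 * ‖t‖ ^ 2 := by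
          rw [integral_add (hY.integrable n fun y ↦ profileDev θ n (fun j ↦ y j)
              (profileShift c t) ^ 2) (integrable_const _)]
          simp
      _ ≤ 16 * θ ^ 2 * (n + θ) * ‖t‖ ^ 2 + 16 * θ ^ 2 * ‖t‖ ^ 2 := by
          have := ih (profileShift c t)
          have : ‖profileShift c t‖ ^ 2 ≤ ‖t‖ ^ 2 := by
            gcongr; exact norm_profileShift_le hc0 hc1 t
          have : 16 * (θ : ℝ) ^ 2 * (n + θ) * ‖profileShift c t‖ ^ 2 ≤
            16 * (θ : ℝ) ^ 2 * (n + θ) * ‖t‖ ^ 2 := by gcongr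
          linarith
      _ = _ := by push_cast; ring

theorem IsProfileProcess.integral_abs_proportion_sub_le (hθ : 1 ≤ θ)
    (hY : IsProfileProcess μ θ Y) (n : ℕ) :
    ∫ ω, ∑ i : Fin 3, |(Y n ω i.castSucc : ℝ) / (n + θ : ℕ) - profileMean θ i| ∂μ ≤
      30 * θ ^ 2 / √(n + θ) := by
  have hθ1 : (1 : ℝ) ≤ θ := by exact_mod_cast hθ
  have hN : (0 : ℝ) < n + θ := by positivity
  set r := √((n : ℝ) + θ) with hr
  have hr0 : 0 < r := Real.sqrt_pos.2 hN
  have hr2 : (n : ℝ) + θ = r ^ 2 := (Real.sq_sqrt hN.le).symm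
  have hterm (i : Fin 3) :
      ∫ ω, |(Y n ω i.castSucc : ℝ) / (n + θ : ℕ) - profileMean θ i| ∂μ ≤ 10 * θ ^ 2 / r := by
    have hsingle (ω : Ω) : profileDev θ n (fun j ↦ Y n ω j) (Pi.single i 1) =
        Y n ω i.castSucc - (n + θ) * profileMean θ i := by
      simp [profileDev, Pi.single_apply]
    have hsq := hY.integral_sq_profileDev_le hθ n (Pi.single i 1)
    have hnorm : ‖(Pi.single i 1 : Fin 3 → ℝ)‖ = 1 := by simp [Pi.norm_single]
    rw [hnorm] at hsq
    have hint := hY.integrable n fun y ↦ profileDev θ n (fun j ↦ y j) (Pi.single i 1) ^ 2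
    calc _ ≤ ∫ ω, (1 / (2 * r) + 1 / (2 * r ^ 3) *
            profileDev θ n (fun j ↦ Y n ω j) (Pi.single i 1) ^ 2) ∂μ := by
          refine integral_mono
            (hY.integrable n fun y ↦ |(y i.castSucc : ℝ) / (n + θ : ℕ) - profileMean θ i|)
            ((integrable_const _).add (hint.const_mul _)) fun ω ↦ ?_
          dsimp only
          rw [hsingle]
          set w := (Y n ω i.castSucc : ℝ) - (n + θ) * profileMean θ i with hw
          have : (Y n ω i.castSucc : ℝ) / (n + θ : ℕ) - profileMean θ i = w / r ^ 2 := by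
            rw [← hr2, hw]; push_cast; field_simp
          rw [this, abs_div, abs_of_pos (by positivity : 0 < r ^ 2), ← sq_abs w]
          have hsq : 0 ≤ (r - |w|) ^ 2 / (2 * r ^ 3) := by positivity
          have heq : 1 / (2 * r) + 1 / (2 * r ^ 3) * |w| ^ 2 - |w| / r ^ 2 =
              (r - |w|) ^ 2 / (2 * r ^ 3) := by field_simp; ring
          linarith
      _ = 1 / (2 * r) + 1 / (2 * r ^ 3) *
            ∫ ω, profileDev θ n (fun j ↦ Y n ω j) (Pi.single i 1) ^ 2 ∂μ := by
          rw [integral_add (integrable_const _) (hint.const_mul _), integral_const_mul]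
          simp
      _ ≤ 1 / (2 * r) + 1 / (2 * r ^ 3) * (16 * θ ^ 2 * r ^ 2 * 1 ^ 2) := by
          rw [← hr2]; gcongr
      _ = (1 / 2 + 8 * θ ^ 2) / r := by field_simp; ring
      _ ≤ _ := by gcongr; nlinarith
  rw [integral_finsetSum _ fun i _ ↦ hY.integrable n fun y ↦
    |(y i.castSucc : ℝ) / (n + θ : ℕ) - profileMean θ i|]
  calc _ ≤ ∑ i : Fin 3, 10 * θ ^ 2 / r := sum_le_sum fun i _ ↦ hterm i
    _ = _ := by simp; ring

end Moments

section CharacteristicFunction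

theorem Complex.norm_exp_sub_one_sub_id_le_sq_mul_exp (z : ℂ) :
    ‖Complex.exp z - 1 - z‖ ≤ ‖z‖ ^ 2 * Real.exp ‖z‖ := by
  have := Complex.norm_exp_sub_sum_le_norm_mul_exp z 2
  simpa [sum_range_succ, sub_sub] using this

theorem Complex.norm_exp_sub_quadratic_le_cube_mul_exp (z : ℂ) :
    ‖Complex.exp z - 1 - z - z ^ 2 / 2‖ ≤ ‖z‖ ^ 3 * Real.exp ‖z‖ := by
  have := Complex.norm_exp_sub_sum_le_norm_mul_exp z 3
  simpa [sum_range_succ, sub_sub, add_assoc] using this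

variable {Ω : Type*} {m0 : MeasurableSpace Ω} {μ : Measure Ω} [IsProbabilityMeasure μ] {θ : ℕ}
  {Y : ℕ → Ω → Fin 4 → ℕ}

/-- Pointwise second-order expansion of the one-step conditional characteristic function. -/
theorem norm_sum_hypergeomProb_smul_exp_sub_le (hθ : 1 ≤ θ) (y : Fin 4 → ℕ)
    (hy : θ ≤ ∑ j, y j) (hy1 : 1 < ∑ j, y j) {t : Fin 3 → ℝ} (ht : ‖t‖ ≤ 1) :
    ‖∑ s ∈ piAntidiag univ (θ - 1), hypergeomProb (θ - 1) y s •
        Complex.exp (profileFluct θ y s t * Complex.I) -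
        (Real.exp (-(profileVar θ t / 2)) : ℂ)‖ ≤
      128 * θ ^ 3 * Real.exp (4 * θ) * ‖t‖ ^ 3 + 10 * θ ^ 2 * ‖t‖ ^ 2 * (∑ i : Fin 3,
        |(y i.castSucc : ℝ) / (∑ j, y j : ℕ) - profileMean θ i| + 1 / (∑ j, y j : ℕ)) := by
  have hθ1 : (1 : ℝ) ≤ θ := by exact_mod_cast hθ
  have h1 := sum_hypergeomProb (m := θ - 1) (y := y) (by omega)
  have h2 := sum_hypergeomProb_mul_profileFluct (θ := θ) y (by omega) (by omega) t
  have h3 := abs_sum_hypergeomProb_mul_sq_profileFluct_sub_le hθ y hy hy1 t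
  set V := ∑ s ∈ piAntidiag univ (θ - 1), hypergeomProb (θ - 1) y s * profileFluct θ y s t ^ 2
    with hV
  set v := profileVar θ t with hv
  have hv0 : 0 ≤ v := profileVar_nonneg hθ t
  have hvle : v / 2 ≤ 2 * θ * ‖t‖ ^ 2 := by linarith [profileVar_le hθ t]
  have hcube : ‖∑ s ∈ piAntidiag univ (θ - 1), hypergeomProb (θ - 1) y s •
      (Complex.exp (profileFluct θ y s t * Complex.I) - 1 - profileFluct θ y s t * Complex.I -
        (profileFluct θ y s t * Complex.I) ^ 2 / 2)‖ ≤
      64 * θ ^ 3 * Real.exp (4 * θ) * ‖t‖ ^ 3 := by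
    calc _ ≤ ∑ s ∈ piAntidiag univ (θ - 1), hypergeomProb (θ - 1) y s *
          ((4 * θ * ‖t‖) ^ 3 * Real.exp (4 * θ)) := by
          refine norm_sum_le_of_le _ fun s hs ↦ ?_
          rw [norm_smul, Real.norm_of_nonneg (hypergeomProb_nonneg s)]
          refine mul_le_mul_of_nonneg_left ?_ (hypergeomProb_nonneg s)
          have hf := abs_profileFluct_le y s (θ := θ) (by simpa using hs) t
          refine (Complex.norm_exp_sub_quadratic_le_cube_mul_exp _).trans ?_
          rw [norm_mul, Complex.norm_I, mul_one, Complex.norm_real, Real.norm_eq_abs]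
          gcongr
          exact hf.trans (mul_le_of_le_one_right (by positivity) ht)
      _ = _ := by rw [← sum_mul, h1]; ring
  have hexp : ‖(Real.exp (-(v / 2)) : ℂ) - 1 + v / 2‖ ≤
      64 * θ ^ 3 * Real.exp (4 * θ) * ‖t‖ ^ 3 := by
    have h := Complex.norm_exp_sub_one_sub_id_le_sq_mul_exp (-(v / 2 : ℝ))
    rw [norm_neg, Complex.norm_real, Real.norm_of_nonneg (by positivity)] at h
    push_cast at h ⊢
    rw [sub_neg_eq_add] at h
    refine h.trans ?_
    have ht2 : ‖t‖ ^ 2 ≤ 1 := pow_le_one₀ (norm_nonneg _) ht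
    calc (v / 2) ^ 2 * Real.exp (v / 2)
        ≤ (2 * θ * ‖t‖ ^ 2) ^ 2 * Real.exp (4 * θ) := by
          gcongr
          nlinarith
      _ = 4 * θ ^ 2 * Real.exp (4 * θ) * ‖t‖ ^ 3 * ‖t‖ := by ring
      _ ≤ 64 * θ ^ 3 * Real.exp (4 * θ) * ‖t‖ ^ 3 * 1 := by
          gcongr <;> norm_num
      _ = _ := mul_one _
  have hmain : ∑ s ∈ piAntidiag univ (θ - 1), hypergeomProb (θ - 1) y s •
        Complex.exp (profileFluct θ y s t * Complex.I) - (Real.exp (-(v / 2)) : ℂ) =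
      ∑ s ∈ piAntidiag univ (θ - 1), hypergeomProb (θ - 1) y s •
      (Complex.exp (profileFluct θ y s t * Complex.I) - 1 - profileFluct θ y s t * Complex.I -
        (profileFluct θ y s t * Complex.I) ^ 2 / 2) -
      ((Real.exp (-(v / 2)) : ℂ) - 1 + v / 2) - ((V - v : ℝ) : ℂ) / 2 := by
    have e1 : (∑ s ∈ piAntidiag univ (θ - 1), (hypergeomProb (θ - 1) y s : ℂ)) = 1 := by
      exact_mod_cast h1
    have e2 : (∑ s ∈ piAntidiag univ (θ - 1),
        (hypergeomProb (θ - 1) y s : ℂ) * profileFluct θ y s t) = 0 := by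
      exact_mod_cast h2
    have e3 : (∑ s ∈ piAntidiag univ (θ - 1),
        (hypergeomProb (θ - 1) y s : ℂ) * profileFluct θ y s t ^ 2) = V := by
      rw [hV]; push_cast; rfl
    simp only [Complex.real_smul, mul_sub, sum_sub_distrib, mul_one, e1]
    have e2' : (∑ s ∈ piAntidiag univ (θ - 1),
        (hypergeomProb (θ - 1) y s : ℂ) * (profileFluct θ y s t * Complex.I)) = 0 := by
      simp_rw [← mul_assoc]
      rw [← sum_mul, e2, zero_mul]
    have e3' : (∑ s ∈ piAntidiag univ (θ - 1), (hypergeomProb (θ - 1) y s : ℂ) *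
        ((profileFluct θ y s t * Complex.I) ^ 2 / 2)) = -(V : ℂ) / 2 := by
      rw [← e3, neg_div, sum_div, ← sum_neg_distrib]
      refine sum_congr rfl fun s _ ↦ ?_
      rw [mul_pow, Complex.I_sq]
      ring
    rw [e2', e3']
    push_cast
    ring
  rw [hmain]
  refine (norm_sub_le _ _).trans ((add_le_add ((norm_sub_le _ _).trans
    (add_le_add hcube hexp)) (le_of_eq ?_)).trans (b := _ + |V - v| / 2) ?_)
  · rw [norm_div, Complex.norm_real, Real.norm_eq_abs]; simp
  · linarith

/-- The characteristic function of the centred profile. -/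
noncomputable def profileChar (μ : Measure Ω) (θ : ℕ) (Y : ℕ → Ω → Fin 4 → ℕ) (n : ℕ)
    (t : Fin 3 → ℝ) : ℂ :=
  ∫ ω, Complex.exp (profileDev θ n (fun j ↦ Y n ω j) t * Complex.I) ∂μ

/-- One-step recursion for the characteristic function, up to a small error. -/
theorem IsProfileProcess.norm_profileChar_succ_sub_le (hθ : 2 ≤ θ) (hY : IsProfileProcess μ θ Y)
    (n : ℕ) {t : Fin 3 → ℝ} (ht : ‖t‖ ≤ 1) :
    ‖profileChar μ θ Y (n + 1) t - Real.exp (-(profileVar θ t / 2)) *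
        profileChar μ θ Y n (profileShift (((θ - 1 : ℕ) : ℝ) / (n + θ : ℕ)) t)‖ ≤
      128 * θ ^ 3 * Real.exp (4 * θ) * ‖t‖ ^ 3 + 310 * θ ^ 4 * ‖t‖ ^ 2 / √(n + θ) := by
  have hθ1 : (1 : ℝ) ≤ θ := by exact_mod_cast (by omega : 1 ≤ θ)
  set c := ((θ - 1 : ℕ) : ℝ) / (n + θ : ℕ) with hc
  set e : (Fin 4 → ℕ) → ℂ := fun y ↦
    Complex.exp (profileDev θ n (fun j ↦ y j) (profileShift c t) * Complex.I)
  set p : (Fin 4 → ℕ) → ℂ := fun y ↦ ∑ s ∈ piAntidiag univ (θ - 1),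
    hypergeomProb (θ - 1) y s • Complex.exp (profileFluct θ y s t * Complex.I)
  have hstep : profileChar μ θ Y (n + 1) t = ∫ ω, e (Y n ω) * p (Y n ω) ∂μ := by
    rw [profileChar, hY.integral_succ n
      (fun y ↦ Complex.exp (profileDev θ (n + 1) y t * Complex.I))]
    refine integral_congr_ae ?_
    filter_upwards [hY.sum_eq n] with ω hω
    simp only [e, p, mul_sum]
    refine sum_congr rfl fun s _ ↦ ?_
    rw [profileDev_succ (by omega) n _ _ hω, hω, Complex.ofReal_add, add_mul, Complex.exp_add,
      mul_smul_comm]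
  have hdiff : profileChar μ θ Y (n + 1) t - Real.exp (-(profileVar θ t / 2)) *
      profileChar μ θ Y n (profileShift c t) =
      ∫ ω, e (Y n ω) * (p (Y n ω) - Real.exp (-(profileVar θ t / 2))) ∂μ := by
    rw [hstep, profileChar, ← integral_const_mul, ← integral_sub
      (hY.integrable n fun y ↦ e y * p y)
      (hY.integrable n fun y ↦ (Real.exp (-(profileVar θ t / 2)) : ℂ) * e y)]
    exact integral_congr_ae (.of_forall fun ω ↦ by simp only [e]; ring)
  rw [hdiff]
  set K := 128 * (θ : ℝ) ^ 3 * Real.exp (4 * θ) * ‖t‖ ^ 3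
  have hsint := hY.integrable n fun y ↦
    ∑ i : Fin 3, |(y i.castSucc : ℝ) / (n + θ : ℕ) - profileMean θ i|
  have hsint' : Integrable (fun ω ↦ ∑ i : Fin 3,
      |(Y n ω i.castSucc : ℝ) / (n + θ : ℕ) - profileMean θ i| + 1 / ((n + θ : ℕ) : ℝ)) μ :=
    hsint.add (integrable_const _)
  have hinv : 1 / ((n + θ : ℕ) : ℝ) ≤ θ ^ 2 / √(n + θ) := by
    push_cast
    have hN : (1 : ℝ) ≤ n + θ := by linarith [(Nat.cast_nonneg n : (0 : ℝ) ≤ n)]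
    have hle : √((n : ℝ) + θ) ≤ n + θ := Real.sqrt_le_iff.2 ⟨by linarith, by nlinarith⟩
    exact div_le_div₀ (by positivity) (by nlinarith) (by positivity) hle
  calc _ ≤ ∫ ω, (K + 10 * θ ^ 2 * ‖t‖ ^ 2 * (∑ i : Fin 3,
        |(Y n ω i.castSucc : ℝ) / (n + θ : ℕ) - profileMean θ i| + 1 / (n + θ : ℕ))) ∂μ := by
        refine norm_integral_le_of_norm_le ((integrable_const _).add
          (hsint'.const_mul _)) ?_
        filter_upwards [hY.sum_eq n] with ω hω
        rw [norm_mul, Complex.norm_exp_ofReal_mul_I, one_mul]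
        have := norm_sum_hypergeomProb_smul_exp_sub_le (θ := θ) (by omega) (Y n ω) (by omega)
          (by omega) ht
        rwa [hω] at this
    _ = K + 10 * θ ^ 2 * ‖t‖ ^ 2 * (∫ ω, ∑ i : Fin 3,
        |(Y n ω i.castSucc : ℝ) / (n + θ : ℕ) - profileMean θ i| ∂μ + 1 / (n + θ : ℕ)) := by
        rw [integral_add (integrable_const _) (hsint'.const_mul _), integral_const,
          integral_const_mul, integral_add hsint (integrable_const _)]
        simp
    _ ≤ K + 10 * θ ^ 2 * ‖t‖ ^ 2 * (30 * θ ^ 2 / √(n + θ) + θ ^ 2 / √(n + θ)) := by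
        gcongr
        exact hY.integral_abs_proportion_sub_le (by omega) n
    _ = _ := by ring

end CharacteristicFunction

section Covariance

/-- The limiting covariance matrix of the first three profile coordinates. -/
noncomputable def profileCov (θ : ℕ) : Matrix (Fin 3) (Fin 3) ℝ :=
  !![((θ : ℝ) - 1) ^ 2 / ((θ : ℝ) ^ 2 * (2 * θ - 1)),
     -(((θ : ℝ) - 1) ^ 2 * ((θ : ℝ) ^ 2 + 2 * θ - 1)) /
        ((θ : ℝ) ^ 3 * (2 * θ - 1) ^ 2),
     -(((θ : ℝ) - 1) ^ 2 *
          ((θ : ℝ) ^ 4 + (θ : ℝ) ^ 3 - 7 * (θ : ℝ) ^ 2 + 5 * θ - 1)) /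
        ((θ : ℝ) ^ 4 * (2 * θ - 1) ^ 3);
     -(((θ : ℝ) - 1) ^ 2 * ((θ : ℝ) ^ 2 + 2 * θ - 1)) /
        ((θ : ℝ) ^ 3 * (2 * θ - 1) ^ 2),
     (((θ : ℝ) - 1) ^ 2 *
          (6 * (θ : ℝ) ^ 4 - 6 * (θ : ℝ) ^ 3 + 8 * (θ : ℝ) ^ 2 - 5 * θ + 1)) /
        ((θ : ℝ) ^ 4 * (2 * θ - 1) ^ 3),
     -(((θ : ℝ) - 1) ^ 2 *
          (3 * (θ : ℝ) ^ 6 - 16 * (θ : ℝ) ^ 4 + 32 * (θ : ℝ) ^ 3 -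
            24 * (θ : ℝ) ^ 2 + 8 * θ - 1)) /
        ((θ : ℝ) ^ 5 * (2 * θ - 1) ^ 4);
     -(((θ : ℝ) - 1) ^ 2 *
          ((θ : ℝ) ^ 4 + (θ : ℝ) ^ 3 - 7 * (θ : ℝ) ^ 2 + 5 * θ - 1)) /
        ((θ : ℝ) ^ 4 * (2 * θ - 1) ^ 3),
     -(((θ : ℝ) - 1) ^ 2 *
          (3 * (θ : ℝ) ^ 6 - 16 * (θ : ℝ) ^ 4 + 32 * (θ : ℝ) ^ 3 -
            24 * (θ : ℝ) ^ 2 + 8 * θ - 1)) /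
        ((θ : ℝ) ^ 5 * (2 * θ - 1) ^ 4),
     (((θ : ℝ) - 1) ^ 2 *
          (26 * (θ : ℝ) ^ 8 - 74 * (θ : ℝ) ^ 7 + 112 * (θ : ℝ) ^ 6 -
            152 * (θ : ℝ) ^ 5 + 170 * (θ : ℝ) ^ 4 - 121 * (θ : ℝ) ^ 3 +
            50 * (θ : ℝ) ^ 2 - 11 * θ + 1)) /
        ((θ : ℝ) ^ 6 * (2 * θ - 1) ^ 5)]

/-- The quadratic form of `profileCov`. -/
noncomputable def profileQuad (θ : ℕ) (t : Fin 3 → ℝ) : ℝ :=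
  ∑ i, ∑ j, t i * profileCov θ i j * t j

/-- The entrywise `ℓ¹` norm of `profileCov`. -/
noncomputable def profileCovSum (θ : ℕ) : ℝ := ∑ i, ∑ j, |profileCov θ i j|

theorem profileCovSum_nonneg (θ : ℕ) : 0 ≤ profileCovSum θ :=
  sum_nonneg fun _ _ ↦ sum_nonneg fun _ _ ↦ abs_nonneg _

theorem abs_profileQuad_le (θ : ℕ) (t : Fin 3 → ℝ) :
    |profileQuad θ t| ≤ profileCovSum θ * ‖t‖ ^ 2 := by
  simp only [profileQuad, profileCovSum, sum_mul]
  refine (abs_sum_le_sum_abs _ _).trans (sum_le_sum fun i _ ↦ ?_)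
  refine (abs_sum_le_sum_abs _ _).trans (sum_le_sum fun j _ ↦ ?_)
  rw [abs_mul, abs_mul]
  calc |t i| * |profileCov θ i j| * |t j| ≤ ‖t‖ * |profileCov θ i j| * ‖t‖ := by
        gcongr
        · exact norm_le_pi_norm t i
        · exact norm_le_pi_norm t j
    _ = _ := by ring

theorem profileQuad_smul (θ : ℕ) (c : ℝ) (t : Fin 3 → ℝ) :
    profileQuad θ (c • t) = c ^ 2 * profileQuad θ t := by
  simp only [profileQuad, mul_sum, Pi.smul_apply, smul_eq_mul]
  exact sum_congr rfl fun i _ ↦ sum_congr rfl fun j _ ↦ by ring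

theorem abs_profileQuad_profileDiff_le (θ : ℕ) (t : Fin 3 → ℝ) :
    |profileQuad θ fun i ↦ profileDiff t i.castSucc| ≤ 4 * profileCovSum θ * ‖t‖ ^ 2 := by
  refine (abs_profileQuad_le θ _).trans ?_
  have h : ‖fun i : Fin 3 ↦ profileDiff t i.castSucc‖ ≤ 2 * ‖t‖ :=
    (pi_norm_le_iff_of_nonneg (by positivity)).2 fun i ↦ abs_profileDiff_le t _
  have := profileCovSum_nonneg θ
  calc _ ≤ profileCovSum θ * (2 * ‖t‖) ^ 2 := by gcongr
    _ = _ := by ring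

/-- The discrete Lyapunov equation satisfied by the limiting covariance. -/
theorem profileQuad_recursion {θ : ℕ} (hθ : 1 ≤ θ) {N : ℝ} (hN : N ≠ 0) (t : Fin 3 → ℝ) :
    (N + 1) * profileQuad θ t = N * profileQuad θ (profileShift (((θ - 1 : ℕ) : ℝ) / N) t) +
      profileVar θ t -
      ((θ - 1 : ℕ) : ℝ) ^ 2 * (profileQuad θ fun i ↦ profileDiff t i.castSucc) / N := by
  have h0 : (θ : ℝ) ≠ 0 := by positivity
  have h1 : (1 : ℝ) ≤ θ := by exact_mod_cast hθ
  have h2 : 2 * (θ : ℝ) - 1 ≠ 0 := by linarith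
  have hshift : N * profileQuad θ (profileShift (((θ - 1 : ℕ) : ℝ) / N) t) =
      N * profileQuad θ t + ((θ - 1 : ℕ) : ℝ) * ∑ i, ∑ j, (t i * profileCov θ i j *
        profileDiff t j.castSucc + profileDiff t i.castSucc * profileCov θ i j * t j) +
      ((θ - 1 : ℕ) : ℝ) ^ 2 * (profileQuad θ fun i ↦ profileDiff t i.castSucc) / N := by
    simp only [profileQuad, profileShift, Fin.sum_univ_three]
    field_simp
    ring
  have hlyap : profileQuad θ t = ((θ - 1 : ℕ) : ℝ) * ∑ i, ∑ j, (t i * profileCov θ i j *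
        profileDiff t j.castSucc + profileDiff t i.castSucc * profileCov θ i j * t j) +
      profileVar θ t := by
    simp only [profileQuad, profileVar, Fin.sum_univ_three, profileDiff, profileCov, profileMean,
      Nat.cast_sub hθ, Nat.cast_one]
    simp
    generalize hw : 2 * (θ : ℝ) - 1 = w at h2 ⊢
    field_simp
    rw [← hw]
    ring
  rw [hshift]
  linear_combination hlyap

end Covariance

section Estimates

/-- The sum controlling the accumulated one-step errors. -/
noncomputable def invSqrtSum (θ n : ℕ) : ℝ := ∑ k ∈ range n, 1 / √((k : ℝ) + θ)

theorem invSqrtSum_nonneg (θ n : ℕ) : 0 ≤ invSqrtSum θ n :=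
  sum_nonneg fun _ _ ↦ by positivity

theorem tendsto_invSqrtSum_div (θ : ℕ) :
    Tendsto (fun n : ℕ ↦ invSqrtSum θ n / n) atTop (nhds 0) := by
  have h : Tendsto (fun k : ℕ ↦ 1 / √((k : ℝ) + θ)) atTop (nhds 0) :=
    tendsto_const_nhds.div_atTop (Real.tendsto_sqrt_atTop.comp
      (tendsto_atTop_add_const_right _ _ tendsto_natCast_atTop_atTop))
  refine h.cesaro.congr fun n ↦ ?_
  rw [invSqrtSum, div_eq_inv_mul]

theorem inv_le_inv_sqrt {x : ℝ} (hx : 1 ≤ x) : 1 / x ≤ 1 / √x :=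
  one_div_le_one_div_of_le (Real.sqrt_pos.2 (by linarith))
    (Real.sqrt_le_iff.2 ⟨by linarith, by nlinarith⟩)

variable {θ : ℕ}

/-- The second-order term in the Lyapunov recursion is negligible. -/
theorem abs_sq_mul_profileQuad_profileDiff_div_le (hθ : 1 ≤ θ) (n : ℕ) (t : Fin 3 → ℝ) :
    |((θ - 1 : ℕ) : ℝ) ^ 2 * (profileQuad θ fun i ↦ profileDiff t i.castSucc) / (n + θ)| ≤
      4 * θ ^ 2 * profileCovSum θ * ‖t‖ ^ 2 * (1 / √((n : ℝ) + θ)) := by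
  have hθ1 : (1 : ℝ) ≤ θ := by exact_mod_cast hθ
  have hN : (1 : ℝ) ≤ n + θ := by linarith [(Nat.cast_nonneg n : (0 : ℝ) ≤ n)]
  have hm : ((θ - 1 : ℕ) : ℝ) ≤ θ := by exact_mod_cast Nat.sub_le _ _
  have hS := profileCovSum_nonneg θ
  rw [div_eq_mul_one_div, abs_mul, abs_mul, abs_of_nonneg (sq_nonneg _),
    abs_of_pos (by positivity : (0 : ℝ) < 1 / (n + θ))]
  calc _ ≤ (θ : ℝ) ^ 2 * (4 * profileCovSum θ * ‖t‖ ^ 2) * (1 / √((n : ℝ) + θ)) := by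
        gcongr ?_ ^ 2 * ?_ * ?_
        · exact abs_profileQuad_profileDiff_le θ t
        · exact inv_le_inv_sqrt hN
    _ = _ := by ring

theorem norm_profileShift_div_le (hθ : 1 ≤ θ) (n : ℕ) (t : Fin 3 → ℝ) :
    ‖profileShift (((θ - 1 : ℕ) : ℝ) / (n + θ)) t‖ ≤ ‖t‖ := by
  have hθ1 : (1 : ℝ) ≤ θ := by exact_mod_cast hθ
  have hm : ((θ - 1 : ℕ) : ℝ) ≤ θ := by exact_mod_cast Nat.sub_le _ _
  exact norm_profileShift_le (by positivity) (div_le_one_of_le₀ (by linarith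
    [(Nat.cast_nonneg n : (0 : ℝ) ≤ n)]) (by positivity)) t

theorem neg_le_mul_profileQuad (hθ : 1 ≤ θ) (n : ℕ) (t : Fin 3 → ℝ) :
    -(4 * θ ^ 2 * profileCovSum θ * ‖t‖ ^ 2 * (θ + invSqrtSum θ n)) ≤
      (n + θ) * profileQuad θ t := by
  have hθ1 : (1 : ℝ) ≤ θ := by exact_mod_cast hθ
  have hS := profileCovSum_nonneg θ
  induction n generalizing t with
  | zero =>
    have h := (abs_le.1 (abs_profileQuad_le θ t)).1
    have hK : profileCovSum θ * ‖t‖ ^ 2 ≤ 4 * θ ^ 2 * profileCovSum θ * ‖t‖ ^ 2 := by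
      gcongr
      exact le_mul_of_one_le_left hS (by nlinarith)
    simp only [invSqrtSum, range_zero, sum_empty, Nat.cast_zero, add_zero, zero_add]
    nlinarith
  | succ n ih =>
    have hN : (n : ℝ) + θ ≠ 0 := by positivity
    have hrec := profileQuad_recursion hθ hN t
    have hneg := (abs_le.1 (abs_sq_mul_profileQuad_profileDiff_div_le hθ n t)).2
    have hv := profileVar_nonneg hθ t
    have hsucc : invSqrtSum θ (n + 1) = invSqrtSum θ n + 1 / √((n : ℝ) + θ) := sum_range_succ _ _
    have hH := invSqrtSum_nonneg θ n
    set t' := profileShift (((θ - 1 : ℕ) : ℝ) / (n + θ)) t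
    have ht' : ‖t'‖ ≤ ‖t‖ := norm_profileShift_div_le hθ n t
    have hmono : 4 * θ ^ 2 * profileCovSum θ * ‖t'‖ ^ 2 * (θ + invSqrtSum θ n) ≤
        4 * θ ^ 2 * profileCovSum θ * ‖t‖ ^ 2 * (θ + invSqrtSum θ n) := by gcongr
    have := ih t'
    rw [hsucc]
    push_cast
    linarith

theorem profileQuad_nonneg (hθ : 1 ≤ θ) (t : Fin 3 → ℝ) : 0 ≤ profileQuad θ t := by
  have hlim : Tendsto (fun n : ℕ ↦ -(4 * θ ^ 2 * profileCovSum θ * ‖t‖ ^ 2 *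
      (θ / n + invSqrtSum θ n / n))) atTop (nhds 0) := by
    simpa using (((tendsto_const_div_atTop_nhds_zero_nat (θ : ℝ)).add
      (tendsto_invSqrtSum_div θ)).const_mul (4 * θ ^ 2 * profileCovSum θ * ‖t‖ ^ 2)).neg
  have hlim' : Tendsto (fun n : ℕ ↦ (1 + (θ : ℝ) / n) * profileQuad θ t) atTop
      (nhds (profileQuad θ t)) := by
    simpa using ((tendsto_const_div_atTop_nhds_zero_nat (θ : ℝ)).const_add 1).mul_const
      (profileQuad θ t)
  refine le_of_tendsto_of_tendsto hlim hlim' ?_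
  filter_upwards [eventually_gt_atTop 0] with n hn
  have hn' : (0 : ℝ) < n := by exact_mod_cast hn
  have h := div_le_div_of_nonneg_right (neg_le_mul_profileQuad hθ n t) hn'.le
  convert h using 1 <;> field_simp

theorem posSemidef_profileCov (hθ : 1 ≤ θ) : (profileCov θ).PosSemidef := by
  refine .of_dotProduct_mulVec_nonneg ?_ fun t ↦ ?_
  · ext i j
    fin_cases i <;> fin_cases j <;> simp [profileCov]
  · simpa [dotProduct, Matrix.mulVec, profileQuad, mul_sum, mul_assoc] using profileQuad_nonneg hθ t

theorem Real.abs_exp_neg_sub_exp_neg_le {a b : ℝ} (ha : 0 ≤ a) (hb : 0 ≤ b) :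
    |Real.exp (-a) - Real.exp (-b)| ≤ |a - b| := by
  wlog h : a ≤ b generalizing a b
  · rw [abs_sub_comm, abs_sub_comm a]
    exact this hb ha (le_of_not_ge h)
  have h1 : Real.exp (-b) ≤ Real.exp (-a) := Real.exp_le_exp.2 (by linarith)
  have h2 : Real.exp (-a) ≤ 1 := Real.exp_le_one_iff.2 (by linarith)
  have h3 : Real.exp (-b) = Real.exp (-a) * Real.exp (a - b) := by rw [← Real.exp_add]; ring_nf
  have h4 := Real.add_one_le_exp (a - b)
  have h5 := Real.exp_pos (-a)
  rw [abs_of_nonneg (by linarith), abs_of_nonpos (by linarith)]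
  nlinarith

/-- The constant in the quantitative Gaussian approximation of `profileChar`. -/
noncomputable def approxConst (θ : ℕ) : ℝ :=
  2 * θ + θ * profileCovSum θ + 128 * θ ^ 3 * Real.exp (4 * θ) + 310 * θ ^ 4 +
    2 * θ ^ 2 * profileCovSum θ

variable {Ω : Type*} {m0 : MeasurableSpace Ω} {μ : Measure Ω} [IsProbabilityMeasure μ]
  {Y : ℕ → Ω → Fin 4 → ℕ}

theorem IsProfileProcess.norm_profileChar_zero_sub_le (hθ : 2 ≤ θ) (hY : IsProfileProcess μ θ Y)
    {t : Fin 3 → ℝ} (ht : ‖t‖ ≤ 1) :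
    ‖profileChar μ θ Y 0 t - Real.exp (-(θ * profileQuad θ t / 2))‖ ≤
      (2 * θ + θ * profileCovSum θ) * ‖t‖ := by
  have hθ1 : 1 ≤ θ := by omega
  have hS := profileCovSum_nonneg θ
  have h1 : ‖profileChar μ θ Y 0 t - 1‖ ≤ 2 * θ * ‖t‖ := by
    have hint := hY.integrable 0 fun y ↦
      Complex.exp (profileDev θ 0 (fun j ↦ y j) t * Complex.I)
    calc _ = ‖∫ ω, (Complex.exp (profileDev θ 0 (fun j ↦ Y 0 ω j) t * Complex.I) - 1) ∂μ‖ := by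
          rw [integral_sub hint (integrable_const _)]
          simp [profileChar]
      _ ≤ ∫ ω, 2 * θ * ‖t‖ ∂μ := by
          refine norm_integral_le_of_norm_le (integrable_const _) (.of_forall fun ω ↦ ?_)
          rw [mul_comm]
          exact Real.norm_exp_I_mul_ofReal_sub_one_le.trans (profileDev_zero hθ1 hY t ω)
      _ = _ := by simp
  have hQ := profileQuad_nonneg hθ1 t
  have hQle := (le_abs_self _).trans (abs_profileQuad_le θ t)
  have h2 : ‖(1 : ℂ) - Real.exp (-(θ * profileQuad θ t / 2))‖ ≤ θ * profileCovSum θ * ‖t‖ := by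
    rw [← Complex.ofReal_one, ← Complex.ofReal_sub, Complex.norm_real, Real.norm_eq_abs]
    have := Real.abs_exp_neg_sub_exp_neg_le le_rfl (by positivity : 0 ≤ θ * profileQuad θ t / 2)
    rw [neg_zero, Real.exp_zero, zero_sub, abs_neg, abs_of_nonneg (a := _ / 2) (by positivity)] at this
    refine this.trans ?_
    calc _ ≤ θ * (profileCovSum θ * ‖t‖ ^ 2) / 2 := by gcongr
      _ = θ * profileCovSum θ * ‖t‖ * (‖t‖ / 2) := by ring
      _ ≤ θ * profileCovSum θ * ‖t‖ * 1 := by gcongr; linarith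
      _ = _ := mul_one _
  calc _ ≤ _ := norm_sub_le_norm_sub_add_norm_sub _ (1 : ℂ) _
    _ ≤ _ := by linarith

/-- Quantitative Gaussian approximation of the characteristic function of the profile. -/
theorem IsProfileProcess.norm_profileChar_sub_le (hθ : 2 ≤ θ) (hY : IsProfileProcess μ θ Y)
    (n : ℕ) {t : Fin 3 → ℝ} (ht : ‖t‖ ≤ 1) :
    ‖profileChar μ θ Y n t - Real.exp (-((n + θ) * profileQuad θ t / 2))‖ ≤
      approxConst θ * (‖t‖ + n * ‖t‖ ^ 3 + ‖t‖ ^ 2 * invSqrtSum θ n) := by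
  have hθ1 : 1 ≤ θ := by omega
  have hS := profileCovSum_nonneg θ
  induction n generalizing t with
  | zero =>
    simp only [invSqrtSum, range_zero, sum_empty, Nat.cast_zero, add_zero, zero_add, zero_mul,
      mul_zero]
    refine (hY.norm_profileChar_zero_sub_le hθ ht).trans ?_
    gcongr
    have h1 : 0 ≤ 128 * (θ : ℝ) ^ 3 * Real.exp (4 * θ) := by positivity
    have h2 : 0 ≤ 310 * (θ : ℝ) ^ 4 := by positivity
    have h3 : 0 ≤ 2 * (θ : ℝ) ^ 2 * profileCovSum θ := by positivity
    unfold approxConst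
    linarith
  | succ n ih =>
    have hN : (n : ℝ) + θ ≠ 0 := by positivity
    have hstep := hY.norm_profileChar_succ_sub_le hθ n ht
    simp only [Nat.cast_add] at hstep
    have hrec := profileQuad_recursion hθ1 hN t
    have herr := abs_sq_mul_profileQuad_profileDiff_div_le hθ1 n t
    have hsucc : invSqrtSum θ (n + 1) = invSqrtSum θ n + 1 / √((n : ℝ) + θ) := sum_range_succ _ _
    have hH := invSqrtSum_nonneg θ n
    have hv := profileVar_nonneg hθ1 t
    have hQ := profileQuad_nonneg hθ1 t
    set t' := profileShift (((θ - 1 : ℕ) : ℝ) / (n + θ)) t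
    have ht' : ‖t'‖ ≤ ‖t‖ := norm_profileShift_div_le hθ1 n t
    have hQ' := profileQuad_nonneg hθ1 t'
    set w := ((θ - 1 : ℕ) : ℝ) ^ 2 * (profileQuad θ fun i ↦ profileDiff t i.castSucc) / (n + θ)
    set r := 1 / √((n : ℝ) + θ) with hr
    have hr0 : 0 ≤ r := by positivity
    have hA : 0 ≤ approxConst θ := by unfold approxConst; positivity
    have hmain : ‖(Real.exp (-(profileVar θ t / 2)) : ℂ) * profileChar μ θ Y n t' -
        Real.exp (-(profileVar θ t / 2)) * Real.exp (-((n + θ) * profileQuad θ t' / 2))‖ ≤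
        approxConst θ * (‖t‖ + n * ‖t‖ ^ 3 + ‖t‖ ^ 2 * invSqrtSum θ n) := by
      rw [← mul_sub, norm_mul, Complex.norm_real, Real.norm_of_nonneg (Real.exp_pos _).le]
      calc _ ≤ 1 * (approxConst θ * (‖t'‖ + n * ‖t'‖ ^ 3 + ‖t'‖ ^ 2 * invSqrtSum θ n)) := by
            gcongr
            · exact Real.exp_le_one_iff.2 (by linarith)
            · exact ih (ht'.trans ht)
        _ ≤ _ := by rw [one_mul]; gcongr
    have hgauss : ‖(Real.exp (-(profileVar θ t / 2)) : ℂ) *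
        Real.exp (-((n + θ) * profileQuad θ t' / 2)) -
        Real.exp (-((n + 1 + θ) * profileQuad θ t / 2))‖ ≤
        2 * θ ^ 2 * profileCovSum θ * ‖t‖ ^ 2 * r := by
      rw [← Complex.ofReal_mul, ← Real.exp_add, ← Complex.ofReal_sub, Complex.norm_real,
        Real.norm_eq_abs, ← neg_add]
      refine (Real.abs_exp_neg_sub_exp_neg_le (by positivity) (by positivity)).trans ?_
      have : profileVar θ t / 2 + (n + θ) * profileQuad θ t' / 2 -
          (n + 1 + θ) * profileQuad θ t / 2 = w / 2 := by linarith
      rw [this, abs_div, abs_two]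
      linarith
    have hstep' : 128 * θ ^ 3 * Real.exp (4 * θ) * ‖t‖ ^ 3 + 310 * θ ^ 4 * ‖t‖ ^ 2 / √(n + θ) +
        2 * θ ^ 2 * profileCovSum θ * ‖t‖ ^ 2 * r ≤
        approxConst θ * ‖t‖ ^ 3 + approxConst θ * (‖t‖ ^ 2 * r) := by
      have e1 : 128 * θ ^ 3 * Real.exp (4 * θ) * ‖t‖ ^ 3 ≤ approxConst θ * ‖t‖ ^ 3 := by
        gcongr
        have h1 : 0 ≤ 310 * (θ : ℝ) ^ 4 := by positivity
        have h2 : 0 ≤ 2 * (θ : ℝ) ^ 2 * profileCovSum θ := by positivity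
        have h3 : 0 ≤ 2 * (θ : ℝ) + θ * profileCovSum θ := by positivity
        unfold approxConst
        linarith
      have e2 : (310 * (θ : ℝ) ^ 4 + 2 * θ ^ 2 * profileCovSum θ) * (‖t‖ ^ 2 * r) ≤
          approxConst θ * (‖t‖ ^ 2 * r) := by
        gcongr
        have h1 : 0 ≤ 128 * (θ : ℝ) ^ 3 * Real.exp (4 * θ) := by positivity
        have h3 : 0 ≤ 2 * (θ : ℝ) + θ * profileCovSum θ := by positivity
        unfold approxConst
        linarith
      have e3 : 310 * θ ^ 4 * ‖t‖ ^ 2 / √(n + θ) = 310 * θ ^ 4 * (‖t‖ ^ 2 * r) := by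
        rw [hr]; ring
      rw [e3]
      linarith
    simp only [Nat.cast_add, Nat.cast_one]
    calc _ ≤ _ := norm_sub_le_norm_sub_add_norm_sub _
            ((Real.exp (-(profileVar θ t / 2)) : ℂ) * profileChar μ θ Y n t') _
      _ ≤ _ := add_le_add hstep ((norm_sub_le_norm_sub_add_norm_sub _ _ _).trans
            (add_le_add hmain hgauss))
      _ ≤ _ := by rw [hsucc]; linarith

end Estimates

section Limit

open scoped Matrix

variable {Ω : Type*} {m0 : MeasurableSpace Ω} {μ : Measure Ω} [IsProbabilityMeasure μ] {θ : ℕ}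
  {Y : ℕ → Ω → Fin 4 → ℕ}

theorem IsProfileProcess.tendsto_profileChar (hθ : 2 ≤ θ) (hY : IsProfileProcess μ θ Y)
    (l : Fin 3 → ℝ) :
    Tendsto (fun n : ℕ ↦ profileChar μ θ Y n ((1 / √(n : ℝ)) • l)) atTop
      (nhds (Real.exp (-(profileQuad θ l / 2)))) := by
  have hsqrt : Tendsto (fun n : ℕ ↦ 1 / √(n : ℝ)) atTop (nhds 0) :=
    tendsto_const_nhds.div_atTop (Real.tendsto_sqrt_atTop.comp tendsto_natCast_atTop_atTop)
  have hbound : Tendsto (fun n : ℕ ↦ approxConst θ * (1 / √(n : ℝ) * ‖l‖ +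
      1 / √(n : ℝ) * ‖l‖ ^ 3 + ‖l‖ ^ 2 * (invSqrtSum θ n / n))) atTop (nhds 0) := by
    simpa using (((hsqrt.mul_const ‖l‖).add (hsqrt.mul_const (‖l‖ ^ 3))).add
      ((tendsto_invSqrtSum_div θ).const_mul (‖l‖ ^ 2))).const_mul (approxConst θ)
  have hsmall : ∀ᶠ n : ℕ in atTop, ‖(1 / √(n : ℝ)) • l‖ ≤ 1 := by
    have : Tendsto (fun n : ℕ ↦ ‖(1 / √(n : ℝ)) • l‖) atTop (nhds 0) := by
      simpa using (hsqrt.smul_const l).norm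
    exact this.eventually (eventually_le_nhds one_pos)
  have hgauss : Tendsto (fun n : ℕ ↦ (Real.exp (-((1 + θ / n) * profileQuad θ l / 2)) : ℂ)) atTop
      (nhds (Real.exp (-(profileQuad θ l / 2)))) := by
    refine (Complex.continuous_ofReal.tendsto _).comp ((Real.continuous_exp.tendsto _).comp ?_)
    simpa using ((((tendsto_const_div_atTop_nhds_zero_nat (θ : ℝ)).const_add 1).mul_const
      (profileQuad θ l)).div_const 2).neg
  refine hgauss.congr_dist (squeeze_zero' (.of_forall fun _ ↦ dist_nonneg) ?_ hbound)
  filter_upwards [hsmall, eventually_gt_atTop 0] with n hn hpos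
  have hn0 : (0 : ℝ) < n := by exact_mod_cast hpos
  have hs : 0 < √(n : ℝ) := Real.sqrt_pos.2 hn0
  have hs2 : √(n : ℝ) ^ 2 = n := Real.sq_sqrt hn0.le
  have h := hY.norm_profileChar_sub_le hθ n hn
  rw [profileQuad_smul, norm_smul, Real.norm_of_nonneg (by positivity)] at h
  rw [dist_comm, dist_eq_norm]
  have hquad : ((n : ℝ) + θ) * ((1 / √(n : ℝ)) ^ 2 * profileQuad θ l) / 2 =
      (1 + θ / n) * profileQuad θ l / 2 := by
    rw [div_pow, hs2]
    field_simp
  have hb : 1 / √(n : ℝ) * ‖l‖ + n * (1 / √(n : ℝ) * ‖l‖) ^ 3 +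
      (1 / √(n : ℝ) * ‖l‖) ^ 2 * invSqrtSum θ n =
      1 / √(n : ℝ) * ‖l‖ + 1 / √(n : ℝ) * ‖l‖ ^ 3 + ‖l‖ ^ 2 * (invSqrtSum θ n / n) := by
    rw [mul_pow, mul_pow, div_pow, div_pow, pow_succ √(n : ℝ) 2, hs2]
    field_simp
  rwa [hquad, hb] at h

theorem sum_mul_normalized_eq (n : ℕ) (y : Fin 4 → ℕ) (l : Fin 3 → ℝ) :
    ∑ i : Fin 3, l i * (((y i.castSucc : ℝ) - n * profileMean θ i) / √(n : ℝ)) =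
      profileDev θ n (fun j ↦ y j) ((1 / √(n : ℝ)) • l) +
        1 / √(n : ℝ) * (θ * ∑ i, l i * profileMean θ i) := by
  simp only [profileDev, Fin.sum_univ_three, Pi.smul_apply, smul_eq_mul, Int.cast_natCast]
  ring

theorem IsProfileProcess.tendsto_integral_exp (hθ : 2 ≤ θ) (hY : IsProfileProcess μ θ Y)
    (l : Fin 3 → ℝ) :
    Tendsto (fun n : ℕ ↦ ∫ ω, Complex.exp ((∑ i : Fin 3, l i *
        (((Y n ω i.castSucc : ℝ) - n * profileMean θ i) / √(n : ℝ)) : ℝ) * Complex.I) ∂μ) atTop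
      (nhds (Real.exp (-(profileQuad θ l / 2)))) := by
  have hsqrt : Tendsto (fun n : ℕ ↦ 1 / √(n : ℝ)) atTop (nhds 0) :=
    tendsto_const_nhds.div_atTop (Real.tendsto_sqrt_atTop.comp tendsto_natCast_atTop_atTop)
  have hphase : Tendsto (fun n : ℕ ↦ Complex.exp
      ((1 / √(n : ℝ) * (θ * ∑ i, l i * profileMean θ i) : ℝ) * Complex.I)) atTop (nhds 1) := by
    have hcont : Continuous fun x : ℝ ↦
        Complex.exp ((x * (θ * ∑ i, l i * profileMean θ i) : ℝ) * Complex.I) := by fun_prop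
    simpa [Function.comp_def] using (hcont.tendsto 0).comp hsqrt
  have h := (hY.tendsto_profileChar hθ l).mul hphase
  rw [mul_one] at h
  refine h.congr fun n ↦ ?_
  rw [profileChar, ← integral_mul_const]
  refine integral_congr_ae (.of_forall fun ω ↦ ?_)
  dsimp only
  rw [sum_mul_normalized_eq, Complex.ofReal_add, add_mul, Complex.exp_add]

/-- The centred Gaussian law on `Fin 3 → ℝ` with covariance `profileCov θ`. -/
noncomputable def profileGaussian (θ : ℕ) : Measure (Fin 3 → ℝ) :=
  (ProbabilityTheory.multivariateGaussian 0 (profileCov θ)).map WithLp.ofLp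

instance (θ : ℕ) : IsProbabilityMeasure (profileGaussian θ) :=
  Measure.isProbabilityMeasure_map (by fun_prop)

theorem charFun_multivariateGaussian_profileCov (hθ : 1 ≤ θ) (l : EuclideanSpace ℝ (Fin 3)) :
    charFun (ProbabilityTheory.multivariateGaussian 0 (profileCov θ)) l =
      Real.exp (-(profileQuad θ l.ofLp / 2)) := by
  rw [ProbabilityTheory.charFun_multivariateGaussian (posSemidef_profileCov hθ)]
  have : l.ofLp ⬝ᵥ profileCov θ *ᵥ l.ofLp = profileQuad θ l.ofLp := by
    simp [dotProduct, Matrix.mulVec, profileQuad, mul_sum, mul_assoc]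
  rw [this]
  push_cast
  simp

theorem EuclideanSpace.inner_eq_sum_mul (x l : EuclideanSpace ℝ (Fin 3)) :
    inner ℝ x l = ∑ i, l.ofLp i * x.ofLp i := by
  simp [PiLp.inner_apply]

theorem map_profileGaussian (hθ : 1 ≤ θ) (l : Fin 3 → ℝ) :
    (profileGaussian θ).map (fun x ↦ ∑ i, l i * x i) =
      ProbabilityTheory.gaussianReal 0 (Real.toNNReal (profileQuad θ l)) := by
  have hm : Measurable fun x : Fin 3 → ℝ ↦ ∑ i, l i * x i := by fun_prop
  have : IsProbabilityMeasure ((profileGaussian θ).map fun x ↦ ∑ i, l i * x i) :=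
    Measure.isProbabilityMeasure_map hm.aemeasurable
  refine Measure.ext_of_charFun (funext fun u ↦ ?_)
  have h := charFun_multivariateGaussian_profileCov hθ (WithLp.toLp 2 (u • l))
  rw [charFun_apply] at h
  simp only [EuclideanSpace.inner_eq_sum_mul, profileQuad_smul] at h
  rw [ProbabilityTheory.charFun_gaussianReal, charFun_apply_real,
    integral_map hm.aemeasurable (by fun_prop), profileGaussian,
    integral_map (by fun_prop) (by fun_prop : Measurable _).aestronglyMeasurable,
    Real.coe_toNNReal _ (profileQuad_nonneg hθ l)]
  convert h using 2
  · ext x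
    simp [mul_sum, mul_assoc]
  · push_cast
    ring_nf

theorem IsProfileProcess.tendsto_integral (hθ : 2 ≤ θ) (hY : IsProfileProcess μ θ Y)
    (f : BoundedContinuousFunction (Fin 3 → ℝ) ℝ) :
    Tendsto (fun n : ℕ ↦ ∫ ω, f (fun i ↦
        ((Y n ω i.castSucc : ℝ) - n * profileMean θ i) / √(n : ℝ)) ∂μ) atTop
      (nhds (∫ x, f x ∂(profileGaussian θ))) := by
  set Z : ℕ → Ω → EuclideanSpace ℝ (Fin 3) := fun n ω ↦ WithLp.toLp 2 fun i ↦
    ((Y n ω i.castSucc : ℝ) - n * profileMean θ i) / √(n : ℝ) with hZ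
  have hZm (n : ℕ) : Measurable (Z n) := by
    have := hY.measurable n
    fun_prop
  let P : ℕ → ProbabilityMeasure (EuclideanSpace ℝ (Fin 3)) := fun n ↦
    ⟨μ.map (Z n), Measure.isProbabilityMeasure_map (hZm n).aemeasurable⟩
  let P0 : ProbabilityMeasure (EuclideanSpace ℝ (Fin 3)) :=
    ⟨ProbabilityTheory.multivariateGaussian 0 (profileCov θ), inferInstance⟩
  have hP : Tendsto P atTop (nhds P0) := by
    refine ProbabilityMeasure.tendsto_of_tendsto_charFun fun l ↦ ?_
    change Tendsto (fun n ↦ charFun (μ.map (Z n)) l) atTop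
      (nhds (charFun (ProbabilityTheory.multivariateGaussian 0 (profileCov θ)) l))
    rw [charFun_multivariateGaussian_profileCov (by omega)]
    refine (hY.tendsto_integral_exp hθ l.ofLp).congr fun n ↦ ?_
    rw [charFun_apply, integral_map (hZm n).aemeasurable (by fun_prop)]
    simp only [EuclideanSpace.inner_eq_sum_mul, hZ]
  have h := ProbabilityMeasure.tendsto_iff_forall_integral_tendsto.1 hP
    (f.compContinuous ⟨WithLp.ofLp, by fun_prop⟩)
  rw [profileGaussian, integral_map (by fun_prop) (by fun_prop)]
  refine h.congr fun n ↦ ?_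
  change ∫ x, f (WithLp.ofLp x) ∂(μ.map (Z n)) = _
  rw [integral_map (hZm n).aemeasurable (by fun_prop)]

end Limit

/-- trivariate central limit theorem for the first three containment
levels. For the global containment profile process `(Y_n)` of the hyperrecursive tree
with parameter `θ ≥ 2`, truncated at level `k = 3`, the normalized vectors
`(X_n − (n/θ, (θ−1)n/θ², (θ−1)²n/θ³))/√n`, where `X_n = (Y_{n,1}, Y_{n,2}, Y_{n,3})`,
converge in distribution as `n → ∞` to the trivariate normal law `N_3(0, Σ_∞^{(θ)})`
with the explicitly given symmetric covariance matrix. (The limiting Gaussian law `ν`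
is characterized, à la Cramér–Wold, by all of its one-dimensional projections being
centered Gaussian with the appropriate variances; convergence in distribution is
formulated as convergence of integrals of all bounded continuous test functions.) -/
theorem hyperrecursive_profile_trivariate_clt
    {Ω : Type*} {m0 : MeasurableSpace Ω} {μ : Measure Ω} [IsProbabilityMeasure μ]
    (θ : ℕ) (hθ : 2 ≤ θ)
    (F : ℕ → MeasurableSpace Ω) (hFle : ∀ n, F n ≤ m0) (hFmono : Monotone F)
    (Y : ℕ → Ω → Fin 4 → ℕ)
    (hYadapted : ∀ n, Measurable[F n] (Y n))
    (hY0 : ∀ ω, Y 0 ω = ![θ, 0, 0, 0])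
    (hcond : ∀ n, 1 ≤ n → ∀ s : Fin 4 → ℕ, (∑ i, s i = θ - 1) →
      (μ[(fun ω => if (∀ j : Fin 4,
            (Y n ω j : ℤ) = (Y (n - 1) ω j : ℤ) + replVecZ3 s j)
          then (1 : ℝ) else 0) | F (n - 1)]) =ᵐ[μ]
        (fun ω => (∏ j, ((Y (n - 1) ω j).choose (s j) : ℝ)) /
          ((n - 1 + θ).choose (θ - 1) : ℝ))) :
    let SigmaInf : Matrix (Fin 3) (Fin 3) ℝ :=
      !![((θ : ℝ) - 1) ^ 2 / ((θ : ℝ) ^ 2 * (2 * θ - 1)),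
         -(((θ : ℝ) - 1) ^ 2 * ((θ : ℝ) ^ 2 + 2 * θ - 1)) /
            ((θ : ℝ) ^ 3 * (2 * θ - 1) ^ 2),
         -(((θ : ℝ) - 1) ^ 2 *
              ((θ : ℝ) ^ 4 + (θ : ℝ) ^ 3 - 7 * (θ : ℝ) ^ 2 + 5 * θ - 1)) /
            ((θ : ℝ) ^ 4 * (2 * θ - 1) ^ 3);
         -(((θ : ℝ) - 1) ^ 2 * ((θ : ℝ) ^ 2 + 2 * θ - 1)) /
            ((θ : ℝ) ^ 3 * (2 * θ - 1) ^ 2),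
         (((θ : ℝ) - 1) ^ 2 *
              (6 * (θ : ℝ) ^ 4 - 6 * (θ : ℝ) ^ 3 + 8 * (θ : ℝ) ^ 2 - 5 * θ + 1)) /
            ((θ : ℝ) ^ 4 * (2 * θ - 1) ^ 3),
         -(((θ : ℝ) - 1) ^ 2 *
              (3 * (θ : ℝ) ^ 6 - 16 * (θ : ℝ) ^ 4 + 32 * (θ : ℝ) ^ 3 -
                24 * (θ : ℝ) ^ 2 + 8 * θ - 1)) /
            ((θ : ℝ) ^ 5 * (2 * θ - 1) ^ 4);
         -(((θ : ℝ) - 1) ^ 2 *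
              ((θ : ℝ) ^ 4 + (θ : ℝ) ^ 3 - 7 * (θ : ℝ) ^ 2 + 5 * θ - 1)) /
            ((θ : ℝ) ^ 4 * (2 * θ - 1) ^ 3),
         -(((θ : ℝ) - 1) ^ 2 *
              (3 * (θ : ℝ) ^ 6 - 16 * (θ : ℝ) ^ 4 + 32 * (θ : ℝ) ^ 3 -
                24 * (θ : ℝ) ^ 2 + 8 * θ - 1)) /
            ((θ : ℝ) ^ 5 * (2 * θ - 1) ^ 4),
         (((θ : ℝ) - 1) ^ 2 *
              (26 * (θ : ℝ) ^ 8 - 74 * (θ : ℝ) ^ 7 + 112 * (θ : ℝ) ^ 6 -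
                152 * (θ : ℝ) ^ 5 + 170 * (θ : ℝ) ^ 4 - 121 * (θ : ℝ) ^ 3 +
                50 * (θ : ℝ) ^ 2 - 11 * θ + 1)) /
            ((θ : ℝ) ^ 6 * (2 * θ - 1) ^ 5)]
    -- the asymptotic mean vector `(1/θ, (θ−1)/θ², (θ−1)²/θ³)` (0-indexed)
    let μvec : Fin 3 → ℝ := fun i => ((θ : ℝ) - 1) ^ i.val / (θ : ℝ) ^ (i.val + 1)
    -- the normalized random vectors `(X_n − nμ)/√n`
    let Z : ℕ → Ω → Fin 3 → ℝ := fun n ω i =>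
      ((Y n ω i.castSucc : ℝ) - n * μvec i) / Real.sqrt n
    ∃ ν : Measure (Fin 3 → ℝ), IsProbabilityMeasure ν ∧
      (∀ l : Fin 3 → ℝ,
        ν.map (fun x => ∑ i, l i * x i) =
          ProbabilityTheory.gaussianReal 0
            (Real.toNNReal (∑ i, ∑ j, l i * SigmaInf i j * l j))) ∧
      (∀ f : BoundedContinuousFunction (Fin 3 → ℝ) ℝ,
        Tendsto (fun n : ℕ => ∫ ω, f (Z n ω) ∂μ) atTop (nhds (∫ x, f x ∂ν))) := by
  have hY := isProfileProcess_of_condExp θ hθ F hFle Y hYadapted hY0 hcond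
  exact ⟨profileGaussian θ, inferInstance, map_profileGaussian (by omega),
    hY.tendsto_integral hθ⟩
end
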